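/- There is an absolute constant C > 1 with the following property. For every real β, every integer n ≥ 2, and all reals 0 < b₁ < b₂, and every interval I ⊆ (b₁, b₂): the Lebesgue measure of the set {α ∈ I : limsup_{x→∞} π*_{α,β}(x)·(log x)²/x ≤ 1 − 1/n} is at most ((C−1)/(C−1+1/(3n)))·mes(I). -/

import Mathlib

open MeasureTheory Filter

/-- `piStar α β x` counts the primes `p ≤ x` such that `⌊α p + β⌋` is also prime. -/
noncomputable def piStar (α β x : ℝ) : ℕ :=
  {p : ℕ | p.Prime ∧ (p : ℝ) ≤ x ∧ Nat.Prime (⌊α * p + β⌋).toNat}.ncard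

open ArithmeticFunction in
theorem residueClass_mod_one (a : ZMod 1) : vonMangoldt.residueClass a = fun n => vonMangoldt n := by
  ext n
  rw [vonMangoldt.residueClass, Set.indicator_of_mem]
  exact Subsingleton.elim _ _

theorem psi_isBigO_rpow_one :
    (fun n : ℕ => ∑ k ∈ Finset.Icc 1 n, ArithmeticFunction.vonMangoldt k) =O[atTop]
      fun n => (n : ℝ) ^ (1 : ℝ) := by
  refine Asymptotics.isBigO_of_le' (c := Real.log 4 + 4) _ fun n => ?_
  have h := Chebyshev.psi_le_const_mul_self (x := n) (by positivity)
  rw [Chebyshev.psi, Nat.floor_natCast] at h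
  have e : Finset.Ioc 0 n = Finset.Icc 1 n := by ext; simp [Finset.mem_Icc, Nat.succ_le_iff]
  rw [e] at h
  rw [Real.rpow_one, Real.norm_of_nonneg, Real.norm_of_nonneg]
  · exact h
  · positivity
  · exact Finset.sum_nonneg fun _ _ => ArithmeticFunction.vonMangoldt_nonneg

/-- The normalized error term in the prime number theorem, on a logarithmic scale. -/
noncomputable def psiErr (τ : ℝ) : ℝ := Chebyshev.psi (Real.exp τ) * Real.exp (-τ) - 1

theorem abs_psiErr_le (τ : ℝ) : |psiErr τ| ≤ 10 := by
  have h := Chebyshev.psi_le_const_mul_self (x := Real.exp τ) (by positivity)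
  have h0 := Chebyshev.psi_nonneg (Real.exp τ)
  have h4 : Real.log 4 ≤ 3 := by
    have := Real.log_le_sub_one_of_pos (x := 4) (by norm_num)
    linarith
  have e : Real.exp τ * Real.exp (-τ) = 1 := by rw [← Real.exp_add]; simp
  have hp := Real.exp_pos (-τ)
  rw [psiErr, abs_le]
  constructor
  · nlinarith [mul_nonneg h0 hp.le]
  · have := mul_le_mul_of_nonneg_right h hp.le
    rw [mul_assoc, e] at this
    linarith

theorem measurable_psiErr : Measurable psiErr := by
  unfold psiErr
  exact ((Chebyshev.psi_mono.measurable.comp Real.measurable_exp).mul (by fun_prop)).sub_const 1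

theorem exp_image_Ioi_zero : Real.exp '' Set.Ioi 0 = Set.Ioi 1 := by
  ext t
  constructor
  · rintro ⟨τ, hτ, rfl⟩
    simpa using hτ
  · intro ht
    have : (0:ℝ) < t := lt_trans one_pos ht
    exact ⟨Real.log t, Real.log_pos ht, Real.exp_log this⟩

theorem integral_Ioi_one_eq_integral_exp (g : ℝ → ℂ) :
    ∫ t in Set.Ioi (1:ℝ), g t = ∫ τ in Set.Ioi (0:ℝ), (Real.exp τ : ℂ) * g (Real.exp τ) := by
  rw [← exp_image_Ioi_zero, integral_image_eq_integral_abs_deriv_smul measurableSet_Ioi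
    (fun x _ => (Real.hasDerivAt_exp x).hasDerivWithinAt) Real.exp_injective.injOn]
  refine integral_congr_ae (Eventually.of_forall fun τ => ?_)
  simp only [abs_of_pos (Real.exp_pos τ), Complex.real_smul]

theorem integrableOn_psiErr_mul_exp {c : ℂ} (hc : 0 < c.re) :
    IntegrableOn (fun τ : ℝ => (psiErr τ : ℂ) * Complex.exp (-c * τ)) (Set.Ioi 0) := by
  have h : IntegrableOn (fun τ : ℝ => Complex.exp (-c * τ)) (Set.Ioi 0) :=
    integrableOn_exp_mul_complex_Ioi (by simpa using hc) 0
  refine Integrable.bdd_mul (c := 10) h ?_ (Eventually.of_forall fun τ => ?_)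
  · exact (Complex.measurable_ofReal.comp measurable_psiErr).aestronglyMeasurable
  · rw [Complex.norm_real]; exact abs_psiErr_le τ

open ArithmeticFunction in
theorem exists_continuousOn_laplace_psiErr :
    ∃ G : ℂ → ℂ, ContinuousOn G {s | 1 ≤ s.re} ∧ ∀ s : ℂ, 1 < s.re →
      ∫ τ in Set.Ioi (0:ℝ), (psiErr τ : ℂ) * Complex.exp (-(s - 1) * τ) = G s := by
  refine ⟨fun s => (vonMangoldt.LFunctionResidueClassAux (1 : ZMod 1) s - 1) / s, ?_, ?_⟩
  · refine ((vonMangoldt.continuousOn_LFunctionResidueClassAux _).sub continuousOn_const).div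
      continuousOn_id fun s hs h => ?_
    change s = 0 at h
    subst h
    simp at hs
    linarith
  · intro s hs
    have h0 : s ≠ 0 := by rintro rfl; simp at hs; linarith
    have h1 : s - 1 ≠ 0 := by
      intro h; rw [sub_eq_zero] at h; subst h; simp at hs
    have hA := vonMangoldt.eqOn_LFunctionResidueClassAux (q := 1) (a := 1) isUnit_one hs
    simp only [residueClass_mod_one] at hA
    have hL := LSeries_eq_mul_integral_of_nonneg (fun n => vonMangoldt n) zero_le_one hs
      psi_isBigO_rpow_one (fun n => vonMangoldt_nonneg)
    rw [hL, integral_Ioi_one_eq_integral_exp] at hA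
    have hE : ∫ τ in Set.Ioi (0:ℝ), Complex.exp (-(s - 1) * τ) = 1 / (s - 1) := by
      rw [integral_exp_mul_complex_Ioi (by simpa using hs)]
      rw [Complex.ofReal_zero, mul_zero, Complex.exp_zero, neg_div_neg_eq]
    have hsplit : ∫ τ in Set.Ioi (0:ℝ), (Real.exp τ : ℂ) *
        ((∑ k ∈ Finset.Icc 1 ⌊Real.exp τ⌋₊, (vonMangoldt k : ℂ)) *
          ((Real.exp τ : ℝ) : ℂ) ^ (-(s + 1))) =
        ∫ τ in Set.Ioi (0:ℝ), ((psiErr τ : ℂ) * Complex.exp (-(s - 1) * τ) +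
          Complex.exp (-(s - 1) * τ)) := by
      refine integral_congr_ae (Eventually.of_forall fun τ => ?_)
      have e : Finset.Icc 1 ⌊Real.exp τ⌋₊ = Finset.Ioc 0 ⌊Real.exp τ⌋₊ := by
        ext; simp [Finset.mem_Icc, Nat.succ_le_iff]
      have e2 : (((Real.exp τ : ℝ) : ℂ)) ^ (-(s + 1)) = Complex.exp (-(s + 1) * τ) := by
        rw [Complex.cpow_def_of_ne_zero (by exact_mod_cast (Real.exp_pos τ).ne'),
          ← Complex.ofReal_log (Real.exp_pos τ).le, Real.log_exp, mul_comm]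
      simp only
      rw [e2, e, psiErr, Chebyshev.psi]
      have e3 : Complex.exp (-(s - 1) * τ) = Complex.exp (τ) * (Complex.exp τ * Complex.exp (-(s + 1) * τ)) := by
        rw [← Complex.exp_add, ← Complex.exp_add]; congr 1; ring
      have e4 : Complex.exp (-τ) * Complex.exp τ = 1 := by rw [← Complex.exp_add]; simp
      push_cast
      rw [e3]
      linear_combination (-(∑ x ∈ Finset.Ioc 0 ⌊Real.exp τ⌋₊, (vonMangoldt x : ℂ)) * Complex.exp τ * Complex.exp (-(s + 1) * τ)) * e4
    rw [hsplit, integral_add (integrableOn_psiErr_mul_exp (by simpa using hs))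
      (integrableOn_exp_mul_complex_Ioi (by simpa using hs) 0), hE] at hA
    simp only at hA ⊢
    rw [hA]
    simp only [Nat.totient_one, Nat.cast_one, inv_one]
    field_simp
    ring

/-- The Fejér kernel `(2 - 2 cos v) / v ^ 2`, up to normalization. -/
noncomputable def fejer (v : ℝ) : ℝ := if v = 0 then 1 else (2 - 2 * Real.cos v) / v ^ 2

theorem fejer_nonneg (v : ℝ) : 0 ≤ fejer v := by
  unfold fejer
  split_ifs
  · exact zero_le_one
  · have := Real.cos_le_one v
    exact div_nonneg (by linarith) (sq_nonneg v)

theorem measurable_fejer : Measurable fejer := by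
  unfold fejer
  exact Measurable.ite (measurableSet_singleton 0) measurable_const (by fun_prop)

theorem fejer_le (v : ℝ) : fejer v ≤ 8 * (1 + v ^ 2)⁻¹ := by
  rw [← div_eq_mul_inv, le_div_iff₀ (by positivity)]
  unfold fejer
  split_ifs with h
  · subst h; norm_num
  · have h2 : 0 < v ^ 2 := by positivity
    rw [div_mul_eq_mul_div, div_le_iff₀ h2]
    have h3 := Real.one_sub_sq_div_two_le_cos (x := v)
    have h4 := Real.neg_one_le_cos v
    nlinarith

theorem integrable_fejer : Integrable fejer := by
  refine Integrable.mono' (integrable_inv_one_add_sq.const_mul 8)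
    measurable_fejer.aestronglyMeasurable (Eventually.of_forall fun v => ?_)
  rw [Real.norm_of_nonneg (fejer_nonneg v)]
  exact fejer_le v

theorem fejer_eq_integral (v : ℝ) :
    (fejer v : ℂ) = ∫ u in (-1:ℝ)..1, ((1 - |u| : ℝ) : ℂ) * Complex.exp (u * v * Complex.I) := by
  have hc : Continuous fun u : ℝ =>
      ((1 - |u| : ℝ) : ℂ) * Complex.exp (u * v * Complex.I) := by fun_prop
  rw [← intervalIntegral.integral_add_adjacent_intervals (b := 0)
    (hc.intervalIntegrable _ _) (hc.intervalIntegrable _ _)]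
  have h1 := intervalIntegral.integral_comp_neg (a := 0) (b := 1) (fun u : ℝ =>
      ((1 - |u| : ℝ) : ℂ) * Complex.exp (u * v * Complex.I))
  rw [neg_zero] at h1
  rw [← h1, ← intervalIntegral.integral_add
    (Continuous.intervalIntegrable (by fun_prop) _ _) (hc.intervalIntegrable _ _)]
  have h2 : ∀ u : ℝ, u ∈ Set.uIcc (0:ℝ) 1 → ((1 - |-u| : ℝ) : ℂ) * Complex.exp ((-u : ℝ) * v * Complex.I) +
      ((1 - |u| : ℝ) : ℂ) * Complex.exp (u * v * Complex.I) = ((2 * (1 - u) * Real.cos (u * v) : ℝ) : ℂ) := by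
    intro u hu
    rw [Set.uIcc_of_le zero_le_one] at hu
    rw [abs_neg, abs_of_nonneg hu.1]
    push_cast
    rw [Complex.cos]
    have : -(u:ℂ) * v * Complex.I = -(u * v) * Complex.I := by ring
    rw [this]
    ring
  rw [intervalIntegral.integral_congr h2, intervalIntegral.integral_ofReal]
  congr 1
  unfold fejer
  split_ifs with h
  · subst h
    simp only [mul_zero, Real.cos_zero, mul_one]
    rw [intervalIntegral.integral_eq_sub_of_hasDerivAt (f := fun u => 2 * u - u ^ 2)]
    · norm_num
    · intro u _
      have := ((hasDerivAt_id u).const_mul 2).sub (hasDerivAt_pow 2 u)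
      exact this.congr_deriv (by push_cast; ring)
    · exact Continuous.intervalIntegrable (by fun_prop) _ _
  · rw [intervalIntegral.integral_eq_sub_of_hasDerivAt
      (f := fun u => 2 * (1 - u) * Real.sin (u * v) / v - 2 * Real.cos (u * v) / v ^ 2)]
    · simp; field_simp; ring
    · intro u _
      have hl : HasDerivAt (fun u : ℝ => u * v) v u := by
        simpa using (hasDerivAt_id u).mul_const v
      have := ((((hasDerivAt_id u).const_sub 1).const_mul 2).mul hl.sin).div_const v |>.sub
        ((hl.cos.const_mul 2).div_const (v ^ 2))
      refine this.congr_deriv ?_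
      simp only [id]
      field_simp
      ring
    · exact Continuous.intervalIntegrable (by fun_prop) _ _

theorem fejer_mul_sub_eq_integral (l y τ : ℝ) :
    (fejer (l * (y - τ)) : ℂ) = ∫ u in Set.Icc (-1:ℝ) 1, ((1 - |u| : ℝ) : ℂ) *
      (Complex.exp (l * y * u * Complex.I) * Complex.exp (-(l * u * Complex.I) * τ)) := by
  rw [fejer_eq_integral, intervalIntegral.integral_of_le (by norm_num),
    ← integral_Icc_eq_integral_Ioc]
  refine integral_congr_ae (Eventually.of_forall fun u => ?_)
  simp only
  rw [← Complex.exp_add]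
  congr 2
  push_cast
  ring

theorem integral_psiErr_mul_fejer_damped {G : ℂ → ℂ}
    (hG : ∀ s : ℂ, 1 < s.re →
      ∫ τ in Set.Ioi (0:ℝ), (psiErr τ : ℂ) * Complex.exp (-(s - 1) * τ) = G s)
    (l y : ℝ) {ε : ℝ} (hε : 0 < ε) :
    ∫ τ in Set.Ioi (0:ℝ), (psiErr τ : ℂ) * Complex.exp (-ε * τ) * fejer (l * (y - τ)) =
      ∫ u in Set.Icc (-1:ℝ) 1, ((1 - |u| : ℝ) : ℂ) * Complex.exp (l * y * u * Complex.I) *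
        G (1 + ε + l * u * Complex.I) := by
  have hint : Integrable (fun z : ℝ × ℝ => (psiErr z.1 : ℂ) * Complex.exp (-ε * z.1) *
      (((1 - |z.2| : ℝ) : ℂ) * (Complex.exp (l * y * z.2 * Complex.I) *
        Complex.exp (-(l * z.2 * Complex.I) * z.1))))
      ((volume.restrict (Set.Ioi (0:ℝ))).prod (volume.restrict (Set.Icc (-1:ℝ) 1))) := by
    have h1 := integrableOn_psiErr_mul_exp (c := ε) (by simpa using hε)
    have h2 : IntegrableOn (fun u : ℝ => ((1 - |u| : ℝ) : ℂ)) (Set.Icc (-1:ℝ) 1) :=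
      Continuous.integrableOn_Icc (by fun_prop)
    have h3 := Integrable.mul_prod h1 h2
    refine (Integrable.bdd_mul (c := 1) (f := fun z : ℝ × ℝ => Complex.exp (l * y * z.2 * Complex.I) *
        Complex.exp (-(l * z.2 * Complex.I) * z.1)) h3 ?_ ?_).congr ?_
    · exact Continuous.aestronglyMeasurable (by fun_prop)
    · refine Eventually.of_forall fun z => ?_
      rw [norm_mul, Complex.norm_exp, Complex.norm_exp]
      simp
    · refine Eventually.of_forall fun z => ?_
      simp only
      ring
  simp_rw [fejer_mul_sub_eq_integral, ← integral_const_mul]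
  rw [integral_integral_swap hint]
  refine integral_congr_ae (Eventually.of_forall fun u => ?_)
  simp only
  rw [← hG _ (by simpa using hε), ← integral_const_mul]
  refine integral_congr_ae (Eventually.of_forall fun τ => ?_)
  simp only
  have : Complex.exp (-(1 + ε + l * u * Complex.I - 1) * τ) =
      Complex.exp (-ε * τ) * Complex.exp (-(l * u * Complex.I) * τ) := by
    rw [← Complex.exp_add]; congr 1; ring
  rw [this]
  ring

theorem integrable_fejer_comp {l : ℝ} (hl : 0 < l) (y : ℝ) :
    Integrable fun τ => fejer (l * (y - τ)) := by
  have := (integrable_fejer.comp_mul_left' hl.ne').comp_sub_left y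
  exact this

theorem integral_psiErr_mul_fejer {G : ℂ → ℂ} (hGc : ContinuousOn G {s | 1 ≤ s.re})
    (hG : ∀ s : ℂ, 1 < s.re →
      ∫ τ in Set.Ioi (0:ℝ), (psiErr τ : ℂ) * Complex.exp (-(s - 1) * τ) = G s)
    {l : ℝ} (hl : 0 < l) (y : ℝ) :
    ∫ τ in Set.Ioi (0:ℝ), (psiErr τ : ℂ) * fejer (l * (y - τ)) =
      ∫ u in Set.Icc (-1:ℝ) 1, ((1 - |u| : ℝ) : ℂ) * Complex.exp (l * y * u * Complex.I) *
        G (1 + l * u * Complex.I) := by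
  set ε : ℕ → ℝ := fun n => 1 / ((n : ℝ) + 1)
  have hε : Tendsto ε atTop (nhds 0) := tendsto_one_div_add_atTop_nhds_zero_nat
  have hεp : ∀ n, 0 < ε n := fun n => by positivity
  have hε1 : ∀ n, ε n ≤ 1 := fun n => by
    rw [div_le_one (by positivity)]; linarith [Nat.cast_nonneg (α := ℝ) n]
  have hL : Tendsto (fun n => ∫ τ in Set.Ioi (0:ℝ),
      (psiErr τ : ℂ) * Complex.exp (-ε n * τ) * fejer (l * (y - τ))) atTop
      (nhds (∫ τ in Set.Ioi (0:ℝ), (psiErr τ : ℂ) * fejer (l * (y - τ)))) := by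
    refine tendsto_integral_of_dominated_convergence
      (fun τ => 10 * fejer (l * (y - τ))) ?_ ?_ ?_ ?_
    · intro n
      refine Measurable.aestronglyMeasurable ?_
      exact ((Complex.measurable_ofReal.comp measurable_psiErr).mul (by fun_prop)).mul
        (Complex.measurable_ofReal.comp (measurable_fejer.comp (by fun_prop)))
    · exact ((integrable_fejer_comp hl y).const_mul 10).integrableOn
    · intro n
      filter_upwards [ae_restrict_mem measurableSet_Ioi] with τ hτ
      have hτ : 0 < τ := hτ
      rw [norm_mul, norm_mul, Complex.norm_real, Complex.norm_real,
        Real.norm_of_nonneg (fejer_nonneg _), Complex.norm_exp]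
      refine mul_le_mul_of_nonneg_right ?_ (fejer_nonneg _)
      have h1 : Real.exp ((-(ε n : ℂ) * τ).re) ≤ 1 := by
        rw [Real.exp_le_one_iff]
        simp
        exact mul_nonneg (hεp n).le hτ.le
      calc _ ≤ 10 * 1 := mul_le_mul (abs_psiErr_le τ) h1 (Real.exp_pos _).le (by norm_num)
        _ = 10 := by norm_num
    · refine Eventually.of_forall fun τ => ?_
      have hc : Continuous fun e : ℝ =>
        (psiErr τ : ℂ) * Complex.exp (-e * τ) * fejer (l * (y - τ)) := by fun_prop
      have := (hc.tendsto 0).comp hε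
      simpa [Function.comp_def] using this
  have hmem : ∀ (e u : ℝ), 0 ≤ e → (1 + e + l * u * Complex.I : ℂ) ∈ {s : ℂ | 1 ≤ s.re} := by
    intro e u he
    simpa using he
  obtain ⟨B, hB⟩ : ∃ B, ∀ e ∈ Set.Icc (0:ℝ) 1, ∀ u ∈ Set.Icc (-1:ℝ) 1,
      ‖G (1 + e + l * u * Complex.I)‖ ≤ B := by
    have hc : ContinuousOn (fun z : ℝ × ℝ => G (1 + z.1 + l * z.2 * Complex.I))
        (Set.Icc (0:ℝ) 1 ×ˢ Set.Icc (-1:ℝ) 1) :=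
      hGc.comp (Continuous.continuousOn (by fun_prop)) fun z hz => hmem _ _ hz.1.1
    obtain ⟨B, hB⟩ := (isCompact_Icc.prod isCompact_Icc).exists_bound_of_continuousOn hc
    exact ⟨B, fun e he u hu => hB (e, u) ⟨he, hu⟩⟩
  have hR : Tendsto (fun n => ∫ u in Set.Icc (-1:ℝ) 1,
      ((1 - |u| : ℝ) : ℂ) * Complex.exp (l * y * u * Complex.I) *
        G (1 + ε n + l * u * Complex.I)) atTop
      (nhds (∫ u in Set.Icc (-1:ℝ) 1, ((1 - |u| : ℝ) : ℂ) * Complex.exp (l * y * u * Complex.I) *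
        G (1 + l * u * Complex.I))) := by
    refine tendsto_integral_of_dominated_convergence (fun _ => B) ?_ ?_ ?_ ?_
    · intro n
      refine ContinuousOn.aestronglyMeasurable ?_ measurableSet_Icc
      refine ContinuousOn.mul (Continuous.continuousOn (by fun_prop)) ?_
      exact hGc.comp (Continuous.continuousOn (by fun_prop)) fun u _ => hmem _ _ (hεp n).le
    · exact integrable_const _
    · intro n
      filter_upwards [ae_restrict_mem measurableSet_Icc] with u hu
      have h1 := hB (ε n) ⟨(hεp n).le, hε1 n⟩ u hu
      rw [norm_mul, norm_mul, Complex.norm_exp, Complex.norm_real]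
      have h2 : ‖1 - |u|‖ ≤ 1 := by
        rw [Real.norm_eq_abs, abs_le]
        constructor <;> linarith [abs_nonneg u, abs_le.2 hu]
      have h3 : ((l : ℂ) * y * u * Complex.I).re = 0 := by simp
      rw [h3, Real.exp_zero, mul_one]
      calc _ ≤ 1 * B := mul_le_mul h2 h1 (norm_nonneg _) zero_le_one
        _ = B := one_mul B
    · refine Eventually.of_forall fun u => ?_
      refine Tendsto.const_mul _ ?_
      have hc := (hGc (1 + l * u * Complex.I) (by simp)).tendsto
      refine hc.comp (tendsto_nhdsWithin_iff.2 ⟨?_, Eventually.of_forall fun n => hmem _ _ (hεp n).le⟩)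
      have hc : Continuous fun e : ℝ => (1 + e + l * u * Complex.I : ℂ) := by fun_prop
      have := (hc.tendsto 0).comp hε
      simpa [Function.comp_def] using this
  refine tendsto_nhds_unique hL (hR.congr fun n => ?_)
  exact (integral_psiErr_mul_fejer_damped hG l y (hεp n)).symm

theorem tendsto_integral_psiErr_mul_fejer {l : ℝ} (hl : 0 < l) :
    Tendsto (fun y => ∫ τ in Set.Ioi (0:ℝ), psiErr τ * fejer (l * (y - τ))) atTop (nhds 0) := by
  obtain ⟨G, hGc, hG⟩ := exists_continuousOn_laplace_psiErr
  have h := Real.tendsto_integral_exp_smul_cocompact (Set.indicator (Set.Icc (-1:ℝ) 1)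
    fun u : ℝ => ((1 - |u| : ℝ) : ℂ) * G (1 + l * u * Complex.I))
  have hw : Tendsto (fun y : ℝ => -(l / (2 * Real.pi)) * y) atTop (cocompact ℝ) := by
    refine Tendsto.mono_right ?_ atBot_le_cocompact
    exact tendsto_id.const_mul_atTop_of_neg (by rw [neg_lt_zero]; positivity)
  have h2 := h.comp hw
  have h3 : Tendsto (fun y => ((∫ τ in Set.Ioi (0:ℝ), psiErr τ * fejer (l * (y - τ)) : ℝ) : ℂ))
      atTop (nhds 0) := by
    refine h2.congr fun y => ?_
    rw [← integral_complex_ofReal]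
    push_cast
    rw [integral_psiErr_mul_fejer hGc hG hl y, ← integral_indicator measurableSet_Icc]
    refine integral_congr_ae (Eventually.of_forall fun u => ?_)
    simp only [Set.indicator_apply]
    split_ifs
    · rw [Circle.smul_def, Real.fourierChar_apply, smul_eq_mul]
      have : ((2 * Real.pi * -(u * (-(l / (2 * Real.pi)) * y)) : ℝ) : ℂ) * Complex.I
        = l * y * u * Complex.I := by
        have hpi := Real.pi_ne_zero
        congr 1
        norm_cast
        field_simp
      rw [this]
      push_cast
      ring
    · rw [smul_zero]
  have := (Complex.continuous_re.tendsto 0).comp h3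
  simpa [Function.comp_def] using this

theorem integral_fejer_pos : 0 < ∫ v, fejer v := by
  rw [integral_pos_iff_support_of_nonneg fejer_nonneg integrable_fejer]
  have h : Set.Ioo (0:ℝ) 1 ⊆ Function.support fejer := by
    intro v hv
    have hv0 : v ≠ 0 := hv.1.ne'
    have hc : Real.cos v < 1 := by
      rw [← Real.cos_zero]
      exact Real.cos_lt_cos_of_nonneg_of_le_pi_div_two le_rfl
        (by linarith [Real.two_le_pi, hv.2]) hv.1
    rw [Function.mem_support, fejer, if_neg hv0]
    exact div_ne_zero (by linarith) (pow_ne_zero 2 hv0)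
  refine lt_of_lt_of_le ?_ (measure_mono h)
  simp

theorem exists_lt_integral_Icc_fejer {η : ℝ} (hη : 0 < η) :
    ∃ W : ℝ, 0 < W ∧ 10 * ∫ v, fejer v < (η + 10) * ∫ v in -W..W, fejer v := by
  have h := intervalIntegral_tendsto_integral integrable_fejer tendsto_neg_atTop_atBot tendsto_id
  have h2 := h.const_mul (η + 10)
  have h3 : 10 * ∫ v, fejer v < (η + 10) * ∫ v, fejer v := by
    nlinarith [integral_fejer_pos]
  obtain ⟨W, hW, hW0⟩ := ((h2.eventually_const_lt h3).and (eventually_gt_atTop 0)).exists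
  exact ⟨W, hW0, hW⟩

theorem eventually_not_forall_le_psiErr {η δ σ : ℝ} (hη : 0 < η) (hδ : 0 < δ) (hσ : |σ| = 1) :
    ∀ᶠ y in atTop, ¬ ∀ τ ∈ Set.Icc (y - δ) (y + δ), η ≤ σ * psiErr τ := by
  obtain ⟨W, hW, hK⟩ := exists_lt_integral_Icc_fejer hη
  set l := W / δ with hldef
  have hl : 0 < l := div_pos hW hδ
  have ht := (tendsto_integral_psiErr_mul_fejer hl).const_mul σ
  rw [mul_zero] at ht
  have hc : 0 < l⁻¹ * ((η + 10) * (∫ v in -W..W, fejer v) - 10 * ∫ v, fejer v) :=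
    mul_pos (inv_pos.2 hl) (by linarith)
  filter_upwards [ht.eventually_lt_const hc, eventually_gt_atTop δ] with y hy hyδ hcon
  refine absurd hy (not_lt.2 ?_)
  have hI := integrable_fejer_comp hl y
  have e1 : ∫ τ, fejer (l * (y - τ)) = l⁻¹ * ∫ v, fejer v := by
    rw [integral_sub_left_eq_self (fun τ => fejer (l * τ)) volume y,
      Measure.integral_comp_mul_left, abs_of_pos (inv_pos.2 hl), smul_eq_mul]
  have e2 : ∫ τ in Set.Icc (y - δ) (y + δ), fejer (l * (y - τ)) = l⁻¹ * ∫ v in -W..W, fejer v := by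
    rw [integral_Icc_eq_integral_Ioc, ← intervalIntegral.integral_of_le (by linarith),
      intervalIntegral.integral_comp_sub_left (fun τ => fejer (l * τ)) y,
      intervalIntegral.integral_comp_mul_left _ hl.ne', smul_eq_mul]
    congr 2
    · rw [hldef]; field_simp; ring
    · rw [hldef]; field_simp; ring
  have hsub : Set.Icc (y - δ) (y + δ) ⊆ Set.Ioi 0 := fun τ h => by
    have := h.1
    simp only [Set.mem_Ioi]; linarith
  calc l⁻¹ * ((η + 10) * (∫ v in -W..W, fejer v) - 10 * ∫ v, fejer v)
      = (η + 10) * (∫ τ in Set.Icc (y - δ) (y + δ), fejer (l * (y - τ)))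
        - 10 * ∫ τ, fejer (l * (y - τ)) := by rw [e1, e2]; ring
    _ ≤ (η + 10) * (∫ τ in Set.Icc (y - δ) (y + δ), fejer (l * (y - τ)))
        - 10 * ∫ τ in Set.Ioi 0, fejer (l * (y - τ)) := by
      have := setIntegral_le_integral (s := Set.Ioi (0:ℝ)) hI
        (Eventually.of_forall fun τ => fejer_nonneg _)
      linarith
    _ = ∫ τ in Set.Ioi 0, ((η + 10) * (Set.Icc (y - δ) (y + δ)).indicator
          (fun τ => fejer (l * (y - τ))) τ - 10 * fejer (l * (y - τ))) := by
      rw [integral_sub ((hI.indicator measurableSet_Icc).const_mul _).integrableOn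
        (hI.const_mul _).integrableOn, integral_const_mul, integral_const_mul,
        setIntegral_indicator measurableSet_Icc, Set.inter_eq_self_of_subset_right hsub]
    _ ≤ ∫ τ in Set.Ioi 0, σ * (psiErr τ * fejer (l * (y - τ))) := by
      refine integral_mono_ae
        (((hI.indicator measurableSet_Icc).const_mul _).sub (hI.const_mul _)).integrableOn ?_ ?_
      · refine Integrable.const_mul ?_ _
        refine Integrable.bdd_mul (c := 10) hI.integrableOn
          measurable_psiErr.aestronglyMeasurable (Eventually.of_forall abs_psiErr_le)
      · refine Eventually.of_forall fun τ => ?_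
        simp only
        have hK0 := fejer_nonneg (l * (y - τ))
        have hlow : -10 ≤ σ * psiErr τ := by
          refine (abs_le.1 ?_).1
          rw [abs_mul, hσ, one_mul]
          exact abs_psiErr_le τ
        by_cases h : τ ∈ Set.Icc (y - δ) (y + δ)
        · rw [Set.indicator_of_mem h]
          nlinarith [mul_le_mul_of_nonneg_right (hcon τ h) hK0]
        · rw [Set.indicator_of_notMem h]
          nlinarith [mul_le_mul_of_nonneg_right hlow hK0]
    _ = σ * ∫ τ in Set.Ioi 0, psiErr τ * fejer (l * (y - τ)) := integral_const_mul _ _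

theorem psiErr_add_one_mul_exp_le {τ τ' : ℝ} (h : τ ≤ τ') :
    (psiErr τ + 1) * Real.exp (-(τ' - τ)) ≤ psiErr τ' + 1 := by
  have h1 := Chebyshev.psi_mono (Real.exp_le_exp.2 h)
  have h2 : Real.exp (-τ) * Real.exp (-(τ' - τ)) = Real.exp (-τ') := by
    rw [← Real.exp_add]; congr 1; ring
  simp only [psiErr, sub_add_cancel]
  rw [mul_assoc, h2]
  exact mul_le_mul_of_nonneg_right h1 (Real.exp_pos _).le

theorem tendsto_psiErr : Tendsto psiErr atTop (nhds 0) := by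
  rw [Metric.tendsto_nhds]
  intro η₀ hη₀
  obtain ⟨η, hη, hη1, hηη⟩ : ∃ η : ℝ, 0 < η ∧ η < 1 ∧ η ≤ η₀ :=
    ⟨min η₀ (1 / 2), by positivity, by linarith [min_le_right η₀ (1 / 2)], min_le_left _ _⟩
  have hδ : 0 < η / 8 := by positivity
  have h1 := eventually_not_forall_le_psiErr (σ := 1) (half_pos hη) hδ (by simp)
  have h2 := eventually_not_forall_le_psiErr (σ := -1) (half_pos hη) hδ (by simp)
  have h1' := (tendsto_atTop_add_const_right atTop (η / 8) tendsto_id).eventually h1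
  have h2' := (tendsto_atTop_add_const_right atTop (-(η / 8)) tendsto_id).eventually h2
  filter_upwards [h1', h2'] with y hy1 hy2
  rw [dist_zero_right, Real.norm_eq_abs]
  refine lt_of_lt_of_le ?_ hηη
  rw [abs_lt]
  have hexp : ∀ t : ℝ, t ≤ η / 4 → 1 - η / 4 ≤ Real.exp (-t) := fun t ht => by
    linarith [Real.add_one_le_exp (-t)]
  constructor
  · by_contra! hcon
    refine hy2 fun τ hτ => ?_
    simp only [id] at hτ
    have h3 := psiErr_add_one_mul_exp_le (τ := τ) (τ' := y) (by linarith [hτ.2])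
    have h4 := hexp (y - τ) (by linarith [hτ.1])
    by_contra! h5
    nlinarith
  · by_contra! hcon
    refine hy1 fun τ hτ => ?_
    simp only [id] at hτ
    have h3 := psiErr_add_one_mul_exp_le (τ := y) (τ' := τ) (by linarith [hτ.1])
    have h4 := hexp (τ - y) (by linarith [hτ.2])
    nlinarith

theorem tendsto_psi_div : Tendsto (fun x => Chebyshev.psi x / x) atTop (nhds 1) := by
  have h := (tendsto_psiErr.comp Real.tendsto_log_atTop).add_const 1
  rw [zero_add] at h
  refine h.congr' ?_
  filter_upwards [eventually_gt_atTop 0] with x hx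
  simp [psiErr, Real.exp_neg, Real.exp_log hx, div_eq_mul_inv]

/-- The **prime number theorem** for the Chebyshev function `θ`. -/
theorem tendsto_theta_div : Tendsto (fun x => Chebyshev.theta x / x) atTop (nhds 1) := by
  have h1 : (Chebyshev.psi - Chebyshev.theta) =o[atTop] (id : ℝ → ℝ) :=
    Chebyshev.isBigO_psi_sub_theta_sqrt.trans_isLittleO <| by
      refine Asymptotics.isLittleO_of_tendsto (fun x hx => by simp_all) ?_
      simp only [id, Real.sqrt_div_self']
      exact tendsto_const_nhds.div_atTop Real.tendsto_sqrt_atTop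
  have h2 := tendsto_psi_div.sub h1.tendsto_div_nhds_zero
  rw [sub_zero] at h2
  refine h2.congr fun x => ?_
  simp only [Pi.sub_apply, id]
  ring

/-- The set of `α` for which `⌊α p + β⌋` is prime. -/
def primeFloorSet (β : ℝ) (p : ℕ) : Set ℝ := {α | Nat.Prime (⌊α * p + β⌋).toNat}

theorem measurableSet_primeFloorSet (β : ℝ) (p : ℕ) : MeasurableSet (primeFloorSet β p) := by
  have h : Measurable fun α : ℝ => ⌊α * p + β⌋ := by fun_prop
  exact h (Set.to_countable {z : ℤ | Nat.Prime z.toNat}).measurableSet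

theorem piStar_natCast (α β : ℝ) (N : ℕ) :
    (piStar α β N : ℝ) =
      ∑ p ∈ (Finset.Icc 1 N).filter Nat.Prime, (primeFloorSet β p).indicator 1 α := by
  classical
  have h : {p : ℕ | p.Prime ∧ (p : ℝ) ≤ N ∧ Nat.Prime (⌊α * p + β⌋).toNat} =
      (((Finset.Icc 1 N).filter Nat.Prime).filter fun p => α ∈ primeFloorSet β p : Finset ℕ) := by
    ext p
    rw [Finset.mem_coe, Finset.mem_filter, Finset.mem_filter, Finset.mem_Icc]
    simp only [Set.mem_ofPred_eq, Nat.cast_le, primeFloorSet]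
    constructor
    · rintro ⟨h1, h2, h3⟩
      exact ⟨⟨⟨h1.one_le, h2⟩, h1⟩, h3⟩
    · rintro ⟨⟨⟨-, h2⟩, h1⟩, h3⟩
      exact ⟨h1, h2, h3⟩
  rw [piStar, h, Set.ncard_coe_finset, Finset.card_filter]
  push_cast
  refine Finset.sum_congr rfl fun p _ => ?_
  simp [Set.indicator_apply]

theorem theta_sub_theta_le {u v : ℝ} (huv : u ≤ v) :
    Chebyshev.theta v - Chebyshev.theta u ≤
      ((Finset.Ioc ⌊u⌋₊ ⌊v⌋₊).filter Nat.Prime).card * Real.log v := by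
  have hf : ⌊u⌋₊ ≤ ⌊v⌋₊ := Nat.floor_mono huv
  have h : Chebyshev.theta v - Chebyshev.theta u =
      ∑ q ∈ (Finset.Ioc ⌊u⌋₊ ⌊v⌋₊).filter Nat.Prime, Real.log q := by
    rw [Chebyshev.theta, Chebyshev.theta, sub_eq_iff_eq_add', Finset.sum_filter, Finset.sum_filter,
      Finset.sum_filter, ← Finset.sum_Ioc_consecutive _ (Nat.zero_le _) hf]
  rw [h, ← nsmul_eq_mul]
  refine Finset.sum_le_card_nsmul _ _ _ fun q hq => ?_
  simp only [Finset.mem_filter, Finset.mem_Ioc] at hq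
  refine Real.log_le_log (by exact_mod_cast hq.2.pos) ?_
  have hv : 0 ≤ v := by
    by_contra! hv
    rw [Nat.floor_of_nonpos hv.le] at hq
    omega
  exact (Nat.le_floor_iff hv).1 hq.1.2

theorem card_div_le_measure_primeFloorSet {a b β : ℝ} {p : ℕ} (hp : 0 < p) :
    (((Finset.Ioc ⌊a * p + β⌋₊ ⌊b * p + β - 1⌋₊).filter Nat.Prime).card : ℝ) / p ≤
      volume.real (primeFloorSet β p ∩ Set.Ioo a b) := by
  have hp' : (0:ℝ) < p := by exact_mod_cast hp
  set Q := (Finset.Ioc ⌊a * p + β⌋₊ ⌊b * p + β - 1⌋₊).filter Nat.Prime with hQ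
  let J : ℕ → Set ℝ := fun q => Set.Ico ((q - β) / p) ((q + 1 - β) / p)
  have hJ : ∀ q α, α ∈ J q → ⌊α * p + β⌋ = q := by
    intro q α h
    rw [Int.floor_eq_iff]
    have h1 := (div_le_iff₀ hp').1 h.1
    have h2 := (lt_div_iff₀ hp').1 h.2
    push_cast
    constructor <;> linarith
  have hsub : (⋃ q ∈ Q, J q) ⊆ primeFloorSet β p ∩ Set.Ioo a b := by
    intro α hα
    simp only [Set.mem_iUnion] at hα
    obtain ⟨q, hq, hα⟩ := hα
    simp only [hQ, Finset.mem_filter, Finset.mem_Ioc] at hq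
    refine ⟨?_, ?_, ?_⟩
    · simp only [primeFloorSet, Set.mem_ofPred_eq, hJ q α hα, Int.toNat_natCast]
      exact hq.2
    · have h1 : a * p + β < q := Nat.lt_of_floor_lt hq.1.1
      refine lt_of_lt_of_le ?_ hα.1
      rw [lt_div_iff₀ hp']
      linarith
    · have h1 : (q:ℝ) ≤ b * p + β - 1 := by
        by_cases hv : 0 ≤ b * p + β - 1
        · exact (Nat.le_floor_iff hv).1 hq.1.2
        · rw [Nat.floor_of_nonpos (not_le.1 hv).le] at hq
          omega
      refine lt_of_lt_of_le hα.2 ?_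
      rw [div_le_iff₀ hp']
      linarith
  have hdisj : Set.PairwiseDisjoint (Q : Set ℕ) J := by
    intro q _ q' _ hne
    refine Set.disjoint_left.2 fun α h1 h2 => hne ?_
    have := (hJ q α h1).symm.trans (hJ q' α h2)
    exact_mod_cast this
  have hm : volume.real (⋃ q ∈ Q, J q) = Q.card / p := by
    rw [measureReal_biUnion_finset hdisj (fun q _ => measurableSet_Ico) (fun q _ => by simp [J])]
    have : ∀ q ∈ Q, volume.real (J q) = 1 / p := by
      intro q _
      simp only [J]
      rw [Real.volume_real_Ico_of_le (by gcongr; linarith)]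
      field_simp
      ring
    rw [Finset.sum_congr rfl this, Finset.sum_const, nsmul_eq_mul]
    ring
  rw [← hm]
  exact measureReal_mono hsub
    (ne_top_of_le_ne_top (by simp : volume (Set.Ioo a b) ≠ ⊤) (measure_mono Set.inter_subset_right))

theorem integral_piStar_natCast (β : ℝ) (N : ℕ) (a b : ℝ) :
    ∫ α in Set.Ioo a b, (piStar α β N : ℝ) =
      ∑ p ∈ (Finset.Icc 1 N).filter Nat.Prime, volume.real (primeFloorSet β p ∩ Set.Ioo a b) := by
  simp_rw [piStar_natCast]
  rw [integral_finsetSum]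
  · refine Finset.sum_congr rfl fun p _ => ?_
    rw [integral_indicator_one (measurableSet_primeFloorSet β p),
      measureReal_restrict_apply (measurableSet_primeFloorSet β p)]
  · intro p _
    exact (integrable_const (1:ℝ)).indicator (measurableSet_primeFloorSet β p)

theorem tendsto_theta_linear_div {c : ℝ} (hc : 0 < c) (d : ℝ) :
    Tendsto (fun t => Chebyshev.theta (c * t + d) / t) atTop (nhds c) := by
  have h1 : Tendsto (fun t : ℝ => c * t + d) atTop atTop :=
    tendsto_atTop_add_const_right _ _ (tendsto_id.const_mul_atTop hc)
  have h2 : Tendsto (fun t : ℝ => c + d / t) atTop (nhds (c + 0)) :=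
    tendsto_const_nhds.add (tendsto_const_nhds.div_atTop tendsto_id)
  have h3 := (tendsto_theta_div.comp h1).mul h2
  rw [one_mul, add_zero] at h3
  refine h3.congr' ?_
  filter_upwards [eventually_gt_atTop 0, h1.eventually_gt_atTop 0] with t ht ht2
  simp only [Function.comp]
  field_simp

theorem eventually_le_theta_sub_theta {a b : ℝ} (ha : 0 < a) (hab : a < b) (β : ℝ) {ε : ℝ}
    (hε : 0 < ε) :
    ∀ᶠ t : ℝ in atTop, (1 - ε) * (b - a) * t ≤
      Chebyshev.theta (b * t + β - 1) - Chebyshev.theta (a * t + β) := by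
  have h := (tendsto_theta_linear_div (ha.trans hab) (β - 1)).sub (tendsto_theta_linear_div ha β)
  have h1 : (1 - ε) * (b - a) < b - a := by nlinarith
  filter_upwards [h.eventually_const_lt h1, eventually_gt_atTop 0] with t ht ht0
  rw [← sub_div, lt_div_iff₀ ht0] at ht
  rw [add_sub_assoc]
  exact ht.le

theorem tendsto_log_div_log_linear {b : ℝ} (hb : 0 < b) {d : ℝ} (hd : 0 ≤ d) :
    Tendsto (fun N : ℕ => Real.log N / Real.log (b * N + d)) atTop (nhds 1) := by
  have hN : Tendsto (fun N : ℕ => (N : ℝ)) atTop atTop := tendsto_natCast_atTop_atTop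
  have h1 : Tendsto (fun N : ℕ => Real.log (b + d / N)) atTop (nhds (Real.log (b + 0))) :=
    ((tendsto_const_nhds (x := b)).add (tendsto_const_nhds.div_atTop hN)).log (by simpa using hb.ne')
  have h2 : Tendsto (fun N : ℕ => 1 + Real.log (b + d / N) / Real.log N) atTop (nhds (1 + 0)) :=
    tendsto_const_nhds.add (h1.div_atTop (Real.tendsto_log_atTop.comp hN))
  have h3 := h2.inv₀ (by norm_num)
  rw [add_zero, inv_one] at h3
  refine h3.congr' ?_
  filter_upwards [eventually_ge_atTop 2] with N hN2
  have hN0 : (0:ℝ) < N := by exact_mod_cast (by omega : 0 < N)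
  have hl : 0 < Real.log N := Real.log_pos (by exact_mod_cast (by omega : 1 < N))
  have e : b * N + d = N * (b + d / N) := by field_simp
  rw [e, Real.log_mul hN0.ne' (by positivity)]
  rw [← inv_div]
  field_simp

theorem eventually_le_integral_piStar {a b : ℝ} (ha : 0 < a) (hab : a < b) (β : ℝ) {ε : ℝ}
    (hε : 0 < ε) :
    ∀ᶠ N : ℕ in atTop, (1 - ε) * (b - a) ≤
      (∫ α in Set.Ioo a b, (piStar α β N : ℝ)) * Real.log N ^ 2 / N := by
  wlog hε1 : ε < 1 generalizing ε
  · filter_upwards [this (ε := 1 / 2) (by norm_num) (by norm_num)] with N hN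
    nlinarith
  have hb := ha.trans hab
  have hN : Tendsto (fun N : ℕ => (N : ℝ)) atTop atTop := tendsto_natCast_atTop_atTop
  obtain ⟨P, hP⟩ := ((hN.eventually (eventually_le_theta_sub_theta ha hab β (half_pos hε))).and
    ((hN.eventually ((tendsto_atTop_add_const_right _ (β - 1)
      (tendsto_id.const_mul_atTop hb)).eventually_gt_atTop 1)).and
      (eventually_gt_atTop 0))).exists_forall_of_atTop
  set κ := (1 - ε / 2) * (b - a) with hκ
  have hκ0 : 0 < κ := mul_pos (by linarith) (by linarith)
  have hlim : Tendsto (fun N : ℕ => κ * (Chebyshev.theta N / N - Chebyshev.theta P / N) *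
      (Real.log N / Real.log (b * N + |β|))) atTop (nhds (κ * (1 - 0) * 1)) :=
    (((tendsto_theta_div.comp hN).sub (tendsto_const_nhds.div_atTop hN)).const_mul κ).mul
      (tendsto_log_div_log_linear hb (abs_nonneg β))
  have hlt : (1 - ε) * (b - a) < κ * (1 - 0) * 1 := by rw [hκ]; nlinarith
  filter_upwards [hlim.eventually_const_lt hlt, eventually_ge_atTop 2, eventually_ge_atTop P,
    eventually_gt_atTop 0] with N hN1 hN2 hNP hN0
  refine hN1.le.trans ?_
  have hN0' : (0:ℝ) < N := by exact_mod_cast hN0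
  have hl : 0 < Real.log N := Real.log_pos (by exact_mod_cast (by omega : 1 < N))
  have hvol : ∀ p : ℕ, P ≤ p → p ≤ N →
      κ / Real.log (b * N + |β|) ≤ volume.real (primeFloorSet β p ∩ Set.Ioo a b) := by
    intro p hPp hpN
    obtain ⟨h1, h2, hp0⟩ := hP p hPp
    simp only [id] at h2
    have hp0' : (0:ℝ) < p := by exact_mod_cast hp0
    refine le_trans ?_ (card_div_le_measure_primeFloorSet hp0)
    have hpN' : (p:ℝ) ≤ N := by exact_mod_cast hpN
    have hlog : 0 < Real.log (b * p + β - 1) := Real.log_pos (by linarith)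
    have hle : Real.log (b * p + β - 1) ≤ Real.log (b * N + |β|) :=
      Real.log_le_log (by linarith) (by nlinarith [le_abs_self β])
    have huv : a * p + β ≤ b * p + β - 1 := by
      by_contra! hcon
      have := Chebyshev.theta_mono hcon.le
      nlinarith
    have h3 := theta_sub_theta_le huv
    have h4 := h1.trans h3
    rw [div_le_div_iff₀ (hlog.trans_le hle) hp0']
    refine h4.trans (mul_le_mul_of_nonneg_left hle (Nat.cast_nonneg _))
  have hL : 0 < Real.log (b * N + |β|) := by
    obtain ⟨h1, h2, -⟩ := hP N hNP
    simp only [id] at h2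
    exact Real.log_pos (by linarith [le_abs_self β])
  have hcount := theta_sub_theta_le (u := P) (v := N) (by exact_mod_cast hNP)
  rw [Nat.floor_natCast, Nat.floor_natCast] at hcount
  set c := ((Finset.Ioc P N).filter Nat.Prime).card with hc
  have hint : c * (κ / Real.log (b * N + |β|)) ≤ ∫ α in Set.Ioo a b, (piStar α β N : ℝ) := by
    rw [integral_piStar_natCast, hc, ← nsmul_eq_mul]
    refine (Finset.card_nsmul_le_sum _ _ _ fun p hp => ?_).trans
      (Finset.sum_le_sum_of_subset_of_nonneg ?_ fun _ _ _ => measureReal_nonneg)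
    · simp only [Finset.mem_filter, Finset.mem_Ioc] at hp
      exact hvol p hp.1.1.le hp.1.2
    · intro p hp
      simp only [Finset.mem_filter, Finset.mem_Ioc, Finset.mem_Icc] at hp ⊢
      exact ⟨⟨hp.2.one_le, hp.1.2⟩, hp.2⟩
  have h5 : (Chebyshev.theta N - Chebyshev.theta P) * (κ / Real.log (b * N + |β|)) ≤
      (∫ α in Set.Ioo a b, (piStar α β N : ℝ)) * Real.log N := by
    calc _ ≤ (c * Real.log N) * (κ / Real.log (b * N + |β|)) :=
          mul_le_mul_of_nonneg_right hcount (by positivity)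
      _ = (c * (κ / Real.log (b * N + |β|))) * Real.log N := by ring
      _ ≤ _ := mul_le_mul_of_nonneg_right hint hl.le
  calc κ * (Chebyshev.theta N / N - Chebyshev.theta P / N) *
      (Real.log N / Real.log (b * N + |β|))
      = (Chebyshev.theta N - Chebyshev.theta P) * (κ / Real.log (b * N + |β|)) *
        (Real.log N / N) := by field_simp
    _ ≤ (∫ α in Set.Ioo a b, (piStar α β N : ℝ)) * Real.log N * (Real.log N / N) :=
      mul_le_mul_of_nonneg_right h5 (by positivity)
    _ = _ := by ring

theorem sum_inv_sq_le_two (z : ℕ) : ∑ m ∈ Finset.Icc 1 z, (1 / (m:ℝ) ^ 2) ≤ 2 := by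
  suffices h : ∀ z : ℕ, ∑ m ∈ Finset.Icc 1 (z + 1), (1 / (m:ℝ) ^ 2) ≤ 2 - 1 / ((z:ℝ) + 1) by
    rcases z with _ | z
    · simp
    · refine (h z).trans ?_
      have : (0:ℝ) ≤ 1 / ((z:ℝ) + 1) := by positivity
      linarith
  intro z
  induction z with
  | zero => norm_num
  | succ z ih =>
    rw [Finset.sum_Icc_succ_top (by omega)]
    refine (add_le_add_left ih _).trans ?_
    have hz : (0:ℝ) ≤ z := z.cast_nonneg
    push_cast
    have : 1 / ((z:ℝ) + 1 + 1) ^ 2 ≤ 1 / (z + 1) - 1 / (z + 1 + 1) := by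
      rw [div_sub_div _ _ (by positivity) (by positivity), div_le_div_iff₀ (by positivity) (by positivity)]
      nlinarith
    linarith

/-- The sum of the reciprocals of the squarefree integers up to `z`. -/
noncomputable def squarefreeHarmonic (z : ℕ) : ℝ :=
  ∑ l ∈ Finset.Icc 1 z, (ArithmeticFunction.moebius l : ℝ) ^ 2 / l

theorem one_le_squarefreeHarmonic {z : ℕ} (hz : 1 ≤ z) : 1 ≤ squarefreeHarmonic z := by
  have h := Finset.single_le_sum (f := fun l : ℕ => (ArithmeticFunction.moebius l : ℝ) ^ 2 / l)
    (fun i _ => by positivity) (Finset.mem_Icc.2 ⟨le_rfl, hz⟩)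
  simpa [squarefreeHarmonic] using h

theorem log_le_two_mul_squarefreeHarmonic (z : ℕ) :
    Real.log z ≤ 2 * squarefreeHarmonic z := by
  have h1 : Real.log z ≤ ∑ n ∈ Finset.Icc 1 z, (1 / (n:ℝ)) := by
    rcases Nat.eq_zero_or_pos z with rfl | hz
    · simp
    · have h := log_add_one_le_harmonic z
      rw [harmonic_eq_sum_Icc] at h
      push_cast at h
      simp only [one_div]
      refine le_trans (Real.log_le_log (by exact_mod_cast hz) (by linarith)) h
  have h2 : ∑ n ∈ Finset.Icc 1 z, (1 / (n:ℝ)) ≤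
      ∑ q ∈ Finset.Icc 1 z ×ˢ Finset.Icc 1 z,
        ((ArithmeticFunction.moebius q.1 : ℝ) ^ 2 / q.1) * (1 / (q.2:ℝ) ^ 2) := by
    choose a b hab hsq using Nat.sq_mul_squarefree
    have hinj : Set.InjOn (fun n => (a n, b n)) (Finset.Icc 1 z : Finset ℕ) := by
      intro m _ n _ h
      simp only [Prod.mk.injEq] at h
      rw [← hab m, ← hab n, h.1, h.2]
    have himg : (Finset.Icc 1 z).image (fun n => (a n, b n)) ⊆
        Finset.Icc 1 z ×ˢ Finset.Icc 1 z := by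
      intro q hq
      obtain ⟨n, hn, rfl⟩ := Finset.mem_image.1 hq
      rw [Finset.mem_Icc] at hn
      have h := hab n
      have ha : 0 < a n := Nat.pos_of_ne_zero fun h0 => by rw [h0] at h; omega
      have hb : 0 < b n := Nat.pos_of_ne_zero fun h0 => by rw [h0] at h; omega
      simp only [Finset.mem_product, Finset.mem_Icc]
      refine ⟨⟨ha, ?_⟩, hb, ?_⟩
      · nlinarith [Nat.le_mul_of_pos_left (a n) (Nat.pow_pos (n := 2) hb)]
      · nlinarith
    refine le_trans (le_of_eq ?_) (Finset.sum_le_sum_of_subset_of_nonneg himg fun _ _ _ => by positivity)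
    rw [Finset.sum_image hinj]
    refine Finset.sum_congr rfl fun n _ => ?_
    have hμ : (ArithmeticFunction.moebius (a n) : ℝ) ^ 2 = 1 := by
      exact_mod_cast ArithmeticFunction.moebius_sq_eq_one_of_squarefree (hsq n)
    have h : (n:ℝ) = (b n : ℝ) ^ 2 * a n := by exact_mod_cast (hab n).symm
    simp only [hμ]
    rw [h, div_mul_div_comm, one_mul, mul_comm]
  rw [Finset.sum_product] at h2
  dsimp only at h2
  rw [← Finset.sum_mul_sum] at h2
  refine h1.trans (h2.trans ?_)
  rw [mul_comm]
  exact mul_le_mul_of_nonneg_right (sum_inv_sq_le_two z)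
    (Finset.sum_nonneg fun _ _ => by positivity)

/-- The diagonalising variables of Selberg's quadratic form. -/
noncomputable def selbergDiag (z l : ℕ) : ℝ :=
  (ArithmeticFunction.moebius l : ℝ) / (l * squarefreeHarmonic z)

/-- Selberg's weights, divided by their index. -/
noncomputable def selbergRatio (z d : ℕ) : ℝ :=
  ∑ l ∈ (Finset.Icc 1 z).filter (d ∣ ·), (ArithmeticFunction.moebius (l / d) : ℝ) * selbergDiag z l

/-- The weights of Selberg's upper bound sieve of level `z`. -/
noncomputable def selbergWeight (z d : ℕ) : ℝ := d * selbergRatio z d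

theorem abs_moebius_le_one' (l : ℕ) : |(ArithmeticFunction.moebius l : ℝ)| ≤ 1 := by
  exact_mod_cast ArithmeticFunction.abs_moebius_le_one (n := l)

theorem selbergWeight_one {z : ℕ} (hz : 1 ≤ z) : selbergWeight z 1 = 1 := by
  have hG : squarefreeHarmonic z ≠ 0 := by linarith [one_le_squarefreeHarmonic hz]
  have h : ∀ l : ℕ, (ArithmeticFunction.moebius l : ℝ) * selbergDiag z l =
      (ArithmeticFunction.moebius l : ℝ) ^ 2 / l / squarefreeHarmonic z := by
    intro l
    rw [selbergDiag]
    ring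
  simp only [selbergWeight, selbergRatio, Nat.cast_one, one_mul, one_dvd, Finset.filter_true,
    Nat.div_one, h, ← Finset.sum_div]
  exact div_self hG

theorem abs_selbergDiag_le {z l : ℕ} (hl : l ∈ Finset.Icc 1 z) : |selbergDiag z l| ≤ 1 := by
  rw [Finset.mem_Icc] at hl
  have hG := one_le_squarefreeHarmonic (hl.1.trans hl.2)
  have hl1 : (1:ℝ) ≤ l := by exact_mod_cast hl.1
  rw [selbergDiag, abs_div, abs_of_pos (by positivity : 0 < (l:ℝ) * squarefreeHarmonic z)]
  exact div_le_one_of_le₀ ((abs_moebius_le_one' l).trans (by nlinarith)) (by positivity)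

theorem abs_selbergWeight_le {z d : ℕ} (hd : d ≤ z) : |selbergWeight z d| ≤ (z:ℝ) ^ 2 := by
  rw [selbergWeight, abs_mul, Nat.abs_cast, sq]
  refine mul_le_mul (by exact_mod_cast hd) ?_ (abs_nonneg _) (by positivity)
  refine (Finset.abs_sum_le_sum_abs _ _).trans ?_
  have h : ∀ l ∈ (Finset.Icc 1 z).filter (d ∣ ·),
      |(ArithmeticFunction.moebius (l / d) : ℝ) * selbergDiag z l| ≤ 1 := by
    intro l hl
    rw [abs_mul]
    exact mul_le_one₀ (abs_moebius_le_one' _) (abs_nonneg _)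
      (abs_selbergDiag_le (Finset.mem_filter.1 hl).1)
  refine (Finset.sum_le_card_nsmul _ _ _ h).trans ?_
  rw [nsmul_eq_mul, mul_one]
  exact_mod_cast (Finset.card_filter_le _ _).trans (by simp)

theorem sum_selbergRatio {z l : ℕ} (hl : l ∈ Finset.Icc 1 z) :
    ∑ d ∈ (Finset.Icc 1 z).filter (l ∣ ·), selbergRatio z d = selbergDiag z l := by
  have hl1 := (Finset.mem_Icc.1 hl).1
  simp only [selbergRatio]
  have hswap : ∑ d ∈ (Finset.Icc 1 z).filter (l ∣ ·), ∑ m ∈ (Finset.Icc 1 z).filter (d ∣ ·),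
        (ArithmeticFunction.moebius (m / d) : ℝ) * selbergDiag z m =
      ∑ m ∈ (Finset.Icc 1 z).filter (l ∣ ·), ∑ d ∈ m.divisors.filter (l ∣ ·),
        (ArithmeticFunction.moebius (m / d) : ℝ) * selbergDiag z m := by
    refine Finset.sum_comm' fun d m => ?_
    simp only [Finset.mem_filter, Finset.mem_Icc, Nat.mem_divisors]
    constructor
    · rintro ⟨⟨⟨h1, h2⟩, h3⟩, ⟨h4, h5⟩, h6⟩
      exact ⟨⟨⟨h6, by omega⟩, h3⟩, ⟨h4, h5⟩, h3.trans h6⟩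
    · rintro ⟨⟨⟨h1, h2⟩, h3⟩, ⟨h4, h5⟩, h6⟩
      exact ⟨⟨⟨Nat.pos_of_dvd_of_pos h1 h4, (Nat.le_of_dvd h4 h1).trans h5⟩, h3⟩, ⟨h4, h5⟩, h1⟩
  rw [hswap]
  have hinner : ∀ m ∈ (Finset.Icc 1 z).filter (l ∣ ·), ∑ d ∈ m.divisors.filter (l ∣ ·),
        (ArithmeticFunction.moebius (m / d) : ℝ) * selbergDiag z m =
      if m = l then selbergDiag z m else 0 := by
    intro m hm
    simp only [Finset.mem_filter, Finset.mem_Icc] at hm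
    obtain ⟨⟨hm1, -⟩, k, rfl⟩ := hm
    have hk : 0 < k := Nat.pos_of_mul_pos_left hm1
    rw [← Finset.sum_mul]
    have h1 : ∑ d ∈ (l * k).divisors.filter (l ∣ ·),
        (ArithmeticFunction.moebius (l * k / d) : ℝ) =
        ∑ j ∈ k.divisors, (ArithmeticFunction.moebius (k / j) : ℝ) := by
      symm
      refine Finset.sum_bij (fun j _ => l * j) ?_ ?_ ?_ ?_
      · intro j hj
        rw [Nat.mem_divisors] at hj
        simp only [Finset.mem_filter, Nat.mem_divisors]
        exact ⟨⟨Nat.mul_dvd_mul_left l hj.1, by positivity⟩, Dvd.intro _ rfl⟩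
      · intro i _ j _ h
        exact Nat.eq_of_mul_eq_mul_left hl1 h
      · intro d hd
        simp only [Finset.mem_filter, Nat.mem_divisors] at hd
        obtain ⟨⟨h1, -⟩, j, rfl⟩ := hd
        exact ⟨j, Nat.mem_divisors.2 ⟨Nat.dvd_of_mul_dvd_mul_left hl1 h1, hk.ne'⟩, rfl⟩
      · intro j _
        rw [Nat.mul_div_mul_left _ _ hl1]
    have h2 : ∑ j ∈ k.divisors, (ArithmeticFunction.moebius (k / j) : ℝ) = if k = 1 then 1 else 0 := by
      rw [Nat.sum_div_divisors k (fun j => (ArithmeticFunction.moebius j : ℝ))]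
      have h := DFunLike.congr_fun (ArithmeticFunction.coe_moebius_mul_coe_zeta (R := ℝ)) k
      rw [ArithmeticFunction.coe_mul_zeta_apply, ArithmeticFunction.one_apply] at h
      simpa using h
    rw [h1, h2]
    by_cases h : k = 1
    · simp [h]
    · have : ¬ (l * k = l) := by
        intro h'
        exact h (Nat.eq_of_mul_eq_mul_left hl1 (by rw [h', mul_one]))
      simp [h, this]
  rw [Finset.sum_congr rfl hinner, Finset.sum_ite_eq', if_pos]
  exact Finset.mem_filter.2 ⟨hl, dvd_rfl⟩

/-- The value of Selberg's quadratic form at the Selberg weights. -/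
noncomputable def selbergForm (z : ℕ) : ℝ :=
  ∑ d ∈ Finset.Icc 1 z, ∑ e ∈ Finset.Icc 1 z,
    selbergWeight z d * selbergWeight z e / (Nat.lcm d e : ℝ)

theorem selbergForm_eq (z : ℕ) :
    selbergForm z = ∑ l ∈ Finset.Icc 1 z, (Nat.totient l : ℝ) * selbergDiag z l ^ 2 := by
  have hterm : ∀ d ∈ Finset.Icc 1 z, ∀ e ∈ Finset.Icc 1 z,
      selbergWeight z d * selbergWeight z e / (Nat.lcm d e : ℝ) =
      ∑ l ∈ Finset.Icc 1 z, (Nat.totient l : ℝ) *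
        ((if l ∣ d then selbergRatio z d else 0) * (if l ∣ e then selbergRatio z e else 0)) := by
    intro d hd e he
    rw [Finset.mem_Icc] at hd he
    have hd0 : (d:ℝ) ≠ 0 := by exact_mod_cast (by omega : d ≠ 0)
    have he0 : (e:ℝ) ≠ 0 := by exact_mod_cast (by omega : e ≠ 0)
    have hg : ∑ l ∈ Finset.Icc 1 z, (if l ∣ d ∧ l ∣ e then (Nat.totient l : ℝ) else 0) =
        Nat.gcd d e := by
      rw [← Finset.sum_filter]
      have : (Finset.Icc 1 z).filter (fun l => l ∣ d ∧ l ∣ e) = (Nat.gcd d e).divisors := by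
        ext l
        simp only [Finset.mem_filter, Finset.mem_Icc, Nat.mem_divisors, Nat.dvd_gcd_iff]
        constructor
        · rintro ⟨-, h⟩
          exact ⟨h, (Nat.gcd_pos_of_pos_left e hd.1).ne'⟩
        · rintro ⟨h, -⟩
          exact ⟨⟨Nat.pos_of_dvd_of_pos h.1 hd.1, (Nat.le_of_dvd hd.1 h.1).trans hd.2⟩, h⟩
      rw [this]
      exact_mod_cast Nat.sum_totient (Nat.gcd d e)
    have hgl : (Nat.gcd d e : ℝ) * Nat.lcm d e = d * e := by exact_mod_cast Nat.gcd_mul_lcm d e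
    have hl0 : (Nat.lcm d e : ℝ) ≠ 0 := by
      intro h
      rw [h, mul_zero] at hgl
      exact mul_ne_zero hd0 he0 hgl.symm
    have hrw : ∀ l, (Nat.totient l : ℝ) *
        ((if l ∣ d then selbergRatio z d else 0) * (if l ∣ e then selbergRatio z e else 0)) =
        (if l ∣ d ∧ l ∣ e then (Nat.totient l : ℝ) else 0) * (selbergRatio z d * selbergRatio z e) := by
      intro l
      by_cases h1 : l ∣ d <;> by_cases h2 : l ∣ e <;> simp [h1, h2]
    simp only [hrw]
    rw [← Finset.sum_mul, hg, selbergWeight, selbergWeight, div_eq_iff hl0]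
    linear_combination (-selbergRatio z d * selbergRatio z e) * hgl
  have hsq : ∀ l ∈ Finset.Icc 1 z, ∑ d ∈ Finset.Icc 1 z, ∑ e ∈ Finset.Icc 1 z,
      (Nat.totient l : ℝ) *
        ((if l ∣ d then selbergRatio z d else 0) * (if l ∣ e then selbergRatio z e else 0)) =
      (Nat.totient l : ℝ) * selbergDiag z l ^ 2 := by
    intro l hl
    simp only [← Finset.mul_sum]
    rw [← Finset.sum_mul, ← Finset.sum_filter, sum_selbergRatio hl, sq]
  rw [selbergForm, ← Finset.sum_congr rfl hsq,
    Finset.sum_congr rfl fun d hd => Finset.sum_congr rfl (hterm d hd)]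
  exact (Finset.sum_congr rfl fun d _ => Finset.sum_comm).trans Finset.sum_comm

theorem selbergForm_nonneg (z : ℕ) : 0 ≤ selbergForm z := by
  rw [selbergForm_eq]
  exact Finset.sum_nonneg fun _ _ => by positivity

theorem selbergForm_mul_log_le {z : ℕ} (hz : 1 ≤ z) : selbergForm z * Real.log z ≤ 2 := by
  have hG := one_le_squarefreeHarmonic hz
  have h : selbergForm z * squarefreeHarmonic z ≤ 1 := by
    rw [selbergForm_eq, Finset.sum_mul]
    have hle : ∀ l ∈ Finset.Icc 1 z, (Nat.totient l : ℝ) * selbergDiag z l ^ 2 * squarefreeHarmonic z ≤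
        (ArithmeticFunction.moebius l : ℝ) ^ 2 / l / squarefreeHarmonic z := by
      intro l hl
      have hl0 : (0:ℝ) < l := by exact_mod_cast (Finset.mem_Icc.1 hl).1
      have hφ : (Nat.totient l : ℝ) ≤ l := by exact_mod_cast Nat.totient_le l
      have : (ArithmeticFunction.moebius l : ℝ) ^ 2 / l / squarefreeHarmonic z =
          l * selbergDiag z l ^ 2 * squarefreeHarmonic z := by
        rw [selbergDiag]
        field_simp
      rw [this]
      gcongr
    refine (Finset.sum_le_sum hle).trans ?_
    rw [← Finset.sum_div]
    exact (div_self (by linarith : squarefreeHarmonic z ≠ 0)).le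
  nlinarith [log_le_two_mul_squarefreeHarmonic z, selbergForm_nonneg z]

/-- The discrepancy of the arc `[0, h)` modulo one: if `0 ≤ h ≤ 1` this is the indicator
of `Int.fract t < h` minus `h`. -/
noncomputable def arcDisc (h t : ℝ) : ℝ := Int.fract (t - h) - Int.fract t

theorem abs_fract_sub_fract_le_one (s t : ℝ) : |Int.fract s - Int.fract t| ≤ 1 := by
  rw [abs_le]
  constructor <;>
    linarith [Int.fract_nonneg s, Int.fract_nonneg t, Int.fract_lt_one s, Int.fract_lt_one t]

theorem abs_arcDisc_le_one (h t : ℝ) : |arcDisc h t| ≤ 1 := abs_fract_sub_fract_le_one _ _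

theorem measurable_arcDisc (h : ℝ) : Measurable (arcDisc h) := by
  unfold arcDisc
  fun_prop

theorem arcDisc_add_intCast (h t : ℝ) (k : ℤ) : arcDisc h (t + k) = arcDisc h t := by
  rw [arcDisc, arcDisc, add_sub_right_comm, Int.fract_add_intCast, Int.fract_add_intCast]

theorem arcDisc_inv_floor (e : ℕ) (he : 0 < e) (x : ℝ) :
    arcDisc (1 / e) (x / e) = (if (e : ℤ) ∣ ⌊x⌋ then 1 else 0) - 1 / e := by
  have he' : (0:ℝ) < e := by exact_mod_cast he
  obtain ⟨q, hq⟩ : ∃ q : ℤ, q = ⌊x⌋ / e := ⟨_, rfl⟩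
  obtain ⟨r, hr⟩ : ∃ r : ℤ, r = ⌊x⌋ % e := ⟨_, rfl⟩
  have hr0 : 0 ≤ r := hr ▸ Int.emod_nonneg _ (by exact_mod_cast he.ne')
  have hre : r < e := hr ▸ Int.emod_lt_of_pos _ (by exact_mod_cast he)
  have hx : ⌊x⌋ = e * q + r := by rw [hq, hr]; exact (Int.mul_ediv_add_emod _ _).symm
  have hxr : x = e * q + r + Int.fract x := by
    have := Int.floor_add_fract x
    rw [hx] at this
    push_cast at this
    exact this.symm
  set f := Int.fract x with hf
  have hf0 : 0 ≤ f := Int.fract_nonneg x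
  have hf1 : f < 1 := Int.fract_lt_one x
  have hr0' : (0:ℝ) ≤ r := by exact_mod_cast hr0
  have hre' : (r:ℝ) + 1 ≤ e := by exact_mod_cast hre
  have h1 : Int.fract (x / e) = (r + f) / e := by
    rw [Int.fract_eq_iff]
    refine ⟨by positivity, by rw [div_lt_one he']; linarith, q, ?_⟩
    rw [hxr]
    field_simp
    ring
  have hdvd : (e : ℤ) ∣ ⌊x⌋ ↔ r = 0 := by rw [hr, Int.dvd_iff_emod_eq_zero]
  rw [arcDisc, h1]
  by_cases hr : r = 0
  · rw [if_pos (hdvd.2 hr)]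
    have : Int.fract (x / e - 1 / e) = (e - 1 + f) / e := by
      rw [Int.fract_eq_iff]
      have he1 : (1:ℝ) ≤ e := by exact_mod_cast he
      refine ⟨div_nonneg (by linarith) he'.le, by rw [div_lt_one he']; linarith, q - 1, ?_⟩
      rw [hxr, hr]
      push_cast
      field_simp
      ring
    rw [this, hr]
    push_cast
    field_simp
    ring
  · rw [if_neg (hdvd.not.2 hr)]
    have hr1 : (1:ℝ) ≤ r := by exact_mod_cast (show 1 ≤ r by omega)
    have : Int.fract (x / e - 1 / e) = (r - 1 + f) / e := by
      rw [Int.fract_eq_iff]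
      refine ⟨div_nonneg (by linarith) he'.le, by rw [div_lt_one he']; linarith, q, ?_⟩
      rw [hxr]
      field_simp
      ring
    rw [this]
    field_simp
    ring

theorem sum_fract_add_mul_div {a b : ℕ} (hb : 0 < b) (hab : a.Coprime b) (t : ℝ) :
    ∑ j ∈ Finset.range b, Int.fract (t + a * j / b) =
      Int.fract (b * t) + ∑ j ∈ Finset.range b, (j / b : ℝ) := by
  have : NeZero b := ⟨hb.ne'⟩
  have hb' : (0:ℝ) < b := by exact_mod_cast hb
  set q := ⌊b * t⌋ with hq
  set f := Int.fract (b * t) with hf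
  have ht : b * t = q + f := (Int.floor_add_fract _).symm
  have hf0 : 0 ≤ f := Int.fract_nonneg _
  have hf1 : f < 1 := Int.fract_lt_one _
  let u : ZMod b ≃ ZMod b := Equiv.addLeft (q : ZMod b)
  let v := Units.mulLeft (ZMod.unitOfCoprime a hab)
  have hrange : ∀ F : ZMod b → ℝ, ∑ j ∈ Finset.range b, F (j : ZMod b) = ∑ x : ZMod b, F x := by
    intro F
    refine Finset.sum_bij (fun j _ => (j : ZMod b)) (fun _ _ => Finset.mem_univ _) ?_ ?_ ?_
    · intro i hi j hj h
      rw [ZMod.natCast_eq_natCast_iff'] at h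
      rwa [Nat.mod_eq_of_lt (Finset.mem_range.1 hi), Nat.mod_eq_of_lt (Finset.mem_range.1 hj)] at h
    · intro x _
      exact ⟨x.val, Finset.mem_range.2 x.val_lt, ZMod.natCast_zmod_val x⟩
    · intros; rfl
  have hterm : ∀ j ∈ Finset.range b, Int.fract (t + a * j / b) =
      (((v.trans u) (j : ZMod b)).val + f) / b := by
    intro j _
    have h : (v.trans u) (j : ZMod b) = ((q + a * j : ℤ) : ZMod b) := by
      simp [u, v]
    have hval : ((((q + a * j : ℤ) : ZMod b).val : ℤ)) = (q + a * j) % b := ZMod.val_intCast _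
    have hval' : ((((q + a * j : ℤ) : ZMod b).val : ℝ)) + b * (((q + a * j) / b : ℤ) : ℝ) =
        q + a * j := by
      have := Int.emod_add_mul_ediv (q + a * j) b
      rw [← hval] at this
      exact_mod_cast this
    have hlt : ((((q + a * j : ℤ) : ZMod b).val : ℝ)) + 1 ≤ b := by
      exact_mod_cast ZMod.val_lt ((q + a * j : ℤ) : ZMod b)
    rw [h, Int.fract_eq_iff]
    refine ⟨by positivity, by rw [div_lt_one hb']; linarith, (q + a * j) / b, ?_⟩
    field_simp
    linarith
  rw [Finset.sum_congr rfl hterm, hrange (fun x => (((v.trans u) x).val + f) / b),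
    (v.trans u).sum_comp (fun x => ((x.val : ℝ) + f) / b), ← hrange (fun x => ((x.val : ℝ) + f) / b)]
  have hval : ∀ j ∈ Finset.range b, (((j : ZMod b).val : ℝ) + f) / b = j / b + f / b := by
    intro j hj
    rw [ZMod.val_natCast_of_lt (Finset.mem_range.1 hj), add_div]
  rw [Finset.sum_congr rfl hval, Finset.sum_add_distrib, Finset.sum_const, Finset.card_range,
    nsmul_eq_mul, mul_div_cancel₀ _ hb'.ne', add_comm]

theorem abs_sum_arcDisc_add_mul_div_le {a b : ℕ} (hb : 0 < b) (hab : a.Coprime b) (h t : ℝ) :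
    |∑ j ∈ Finset.range b, arcDisc h (t + a * j / b)| ≤ 1 := by
  have : ∀ j : ℕ, arcDisc h (t + a * j / b) =
      Int.fract (t - h + a * j / b) - Int.fract (t + a * j / b) := by
    intro j
    rw [arcDisc]
    congr 2
    ring
  simp only [this]
  rw [Finset.sum_sub_distrib, sum_fract_add_mul_div hb hab, sum_fract_add_mul_div hb hab,
    add_sub_add_right_eq_sub]
  exact abs_fract_sub_fract_le_one _ _

theorem intervalIntegrable_of_measurable_of_abs_le {f : ℝ → ℝ} (hf : Measurable f) {K : ℝ}
    (hK : ∀ t, |f t| ≤ K) (a b : ℝ) : IntervalIntegrable f volume a b := by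
  rw [intervalIntegrable_iff]
  exact Measure.integrableOn_of_bounded (M := K) (by simp) hf.aestronglyMeasurable
    (Eventually.of_forall fun t => by simpa using hK t)

theorem abs_integral_arcDisc_mul_arcDisc_le (h γ : ℝ) {m n : ℕ} (hn : 0 < n) :
    |∫ θ in (0:ℝ)..1, arcDisc h (m * θ + γ) * arcDisc h (n * θ + γ)| ≤ (Nat.gcd m n : ℝ) / n := by
  obtain ⟨a, ha⟩ := Nat.gcd_dvd_left m n
  obtain ⟨b, hb⟩ := Nat.gcd_dvd_right m n
  have hg : 0 < Nat.gcd m n := Nat.gcd_pos_of_pos_right m hn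
  have hab : a.Coprime b := by
    have := Nat.gcd_mul_left (Nat.gcd m n) a b
    rw [← ha, ← hb] at this
    exact Nat.eq_of_mul_eq_mul_left hg (by rw [mul_one]; exact this.symm)
  set g := Nat.gcd m n with hgdef
  have hb0 : 0 < b := Nat.pos_of_mul_pos_left (hb ▸ hn)
  have hg' : (0:ℝ) < g := by exact_mod_cast hg
  have hb' : (0:ℝ) < b := by exact_mod_cast hb0
  have hm' : (m:ℝ) = g * a := by exact_mod_cast ha
  have hn' : (n:ℝ) = g * b := by exact_mod_cast hb
  set F : ℝ → ℝ := fun θ => arcDisc h (m * θ + γ) * arcDisc h (n * θ + γ) with hF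
  have hmeas : ∀ (c d : ℝ), Measurable fun θ : ℝ => arcDisc h (c * θ + d) := fun c d =>
    (measurable_arcDisc h).comp (by fun_prop)
  have hper : Function.Periodic F 1 := by
    intro θ
    have h1 : ∀ k : ℕ, arcDisc h (k * (θ + 1) + γ) = arcDisc h (k * θ + γ) := by
      intro k
      rw [← arcDisc_add_intCast h (k * θ + γ) k]
      congr 1
      push_cast
      ring
    simp only [hF, h1]
  have hFm : Measurable F := (hmeas m γ).mul (hmeas n γ)
  have hF1 : ∀ t, |F t| ≤ 1 := fun t => by
    rw [hF, abs_mul]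
    exact mul_le_one₀ (abs_arcDisc_le_one _ _) (abs_nonneg _) (abs_arcDisc_le_one _ _)
  have hshift : ∀ s : ℝ, ∫ θ in (0:ℝ)..1, F (θ + s) = ∫ θ in (0:ℝ)..1, F θ := by
    intro s
    rw [intervalIntegral.integral_comp_add_right, zero_add, add_comm,
      hper.intervalIntegral_add_eq s 0, zero_add]
  have hsum : b * ∫ θ in (0:ℝ)..1, F θ =
      ∫ θ in (0:ℝ)..1, (∑ j ∈ Finset.range b, arcDisc h ((m * θ + γ) + a * j / b)) *
        arcDisc h (n * θ + γ) := by
    have h1 : ∀ j ∈ Finset.range b, ∫ θ in (0:ℝ)..1, F (θ + j / (g * b)) = ∫ θ in (0:ℝ)..1, F θ :=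
      fun j _ => hshift _
    have h2 := Finset.sum_congr rfl h1
    rw [Finset.sum_const, Finset.card_range, nsmul_eq_mul] at h2
    rw [← h2, ← intervalIntegral.integral_finsetSum]
    · congr 1
      ext θ
      rw [Finset.sum_mul]
      refine Finset.sum_congr rfl fun j _ => ?_
      simp only [hF]
      congr 1
      · congr 1
        rw [hm']
        field_simp
        ring
      · rw [← arcDisc_add_intCast h (n * θ + γ) j]
        congr 1
        rw [hn']
        push_cast
        field_simp
        ring
    · intro j _
      exact intervalIntegrable_of_measurable_of_abs_le (hFm.comp (by fun_prop)) (fun t => hF1 _) _ _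
  have hbound : |b * ∫ θ in (0:ℝ)..1, F θ| ≤ 1 := by
    rw [hsum]
    have := intervalIntegral.norm_integral_le_of_norm_le_const (a := (0:ℝ)) (b := 1) (C := 1)
      (f := fun θ : ℝ => (∑ j ∈ Finset.range b, arcDisc h ((m * θ + γ) + a * j / b)) *
        arcDisc h (n * θ + γ)) fun θ _ => by
        rw [norm_mul]
        exact mul_le_one₀ (abs_sum_arcDisc_add_mul_div_le hb0 hab _ _) (norm_nonneg _)
          (abs_arcDisc_le_one _ _)
    simpa using this
  rw [abs_mul, abs_of_pos hb'] at hbound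
  rw [hn', div_mul_cancel_left₀ hg'.ne', ← one_div, le_div_iff₀ hb', mul_comm]
  exact hbound

theorem sum_inv_le_one_add_log (M : ℕ) : ∑ k ∈ Finset.Icc 1 M, (1 / (k:ℝ)) ≤ 1 + Real.log M := by
  have h := harmonic_le_one_add_log M
  rw [harmonic_eq_sum_Icc] at h
  push_cast at h
  simpa only [one_div] using h

theorem sum_inv_filter_dvd_le {g : ℕ} (hg : 0 < g) (M : ℕ) :
    ∑ n ∈ (Finset.Icc 1 M).filter (g ∣ ·), (1 / (n:ℝ)) ≤
      1 / g * ∑ k ∈ Finset.Icc 1 M, (1 / (k:ℝ)) := by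
  have hsub : (Finset.Icc 1 M).filter (g ∣ ·) ⊆ (Finset.Icc 1 M).image (g * ·) := by
    intro n hn
    simp only [Finset.mem_filter, Finset.mem_Icc] at hn
    obtain ⟨⟨h1, h2⟩, k, rfl⟩ := hn
    have hk : 0 < k := Nat.pos_of_mul_pos_left h1
    exact Finset.mem_image.2 ⟨k, Finset.mem_Icc.2 ⟨hk, by nlinarith⟩, rfl⟩
  refine (Finset.sum_le_sum_of_subset_of_nonneg hsub fun _ _ _ => by positivity).trans ?_
  rw [Finset.sum_image fun _ _ _ _ h => Nat.eq_of_mul_eq_mul_left hg h, Finset.mul_sum]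
  refine (Finset.sum_congr rfl fun k _ => ?_).le
  push_cast
  rw [div_mul_div_comm, one_mul]

theorem card_filter_dvd_le {g : ℕ} (M : ℕ) :
    (((Finset.Icc 1 M).filter (g ∣ ·)).card : ℝ) ≤ M / g := by
  rw [show Finset.Icc 1 M = Finset.Ioc 0 M from rfl, Nat.Ioc_filter_dvd_card_eq_div]
  exact Nat.cast_div_le

theorem sum_gcd_div_le (M : ℕ) :
    ∑ m ∈ Finset.Icc 1 M, ∑ n ∈ Finset.Icc 1 M, (Nat.gcd m n : ℝ) / n ≤
      M * (1 + Real.log M) ^ 2 := by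
  set H := ∑ k ∈ Finset.Icc 1 M, (1 / (k:ℝ)) with hH
  have hH0 : 0 ≤ H := Finset.sum_nonneg fun _ _ => by positivity
  have hterm : ∀ m ∈ Finset.Icc 1 M, ∀ n ∈ Finset.Icc 1 M, (Nat.gcd m n : ℝ) / n ≤
      ∑ g ∈ Finset.Icc 1 M, (g:ℝ) * ((if g ∣ m then 1 else 0) * (if g ∣ n then 1 / (n:ℝ) else 0)) := by
    intro m hm n hn
    rw [Finset.mem_Icc] at hm hn
    have hg : Nat.gcd m n ∈ Finset.Icc 1 M := Finset.mem_Icc.2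
      ⟨Nat.gcd_pos_of_pos_left n hm.1, (Nat.le_of_dvd hm.1 (Nat.gcd_dvd_left m n)).trans hm.2⟩
    refine le_trans (le_of_eq ?_) (Finset.single_le_sum (f := fun g : ℕ => (g:ℝ) *
      ((if g ∣ m then 1 else 0) * (if g ∣ n then 1 / (n:ℝ) else 0))) (fun g _ => ?_) hg)
    · simp only [Nat.gcd_dvd_left, Nat.gcd_dvd_right, if_true]
      ring
    · positivity
  calc _ ≤ ∑ m ∈ Finset.Icc 1 M, ∑ n ∈ Finset.Icc 1 M, ∑ g ∈ Finset.Icc 1 M,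
        (g:ℝ) * ((if g ∣ m then 1 else 0) * (if g ∣ n then 1 / (n:ℝ) else 0)) :=
        Finset.sum_le_sum fun m hm => Finset.sum_le_sum fun n hn => hterm m hm n hn
    _ = ∑ g ∈ Finset.Icc 1 M, ∑ m ∈ Finset.Icc 1 M, ∑ n ∈ Finset.Icc 1 M,
        (g:ℝ) * ((if g ∣ m then 1 else 0) * (if g ∣ n then 1 / (n:ℝ) else 0)) :=
        (Finset.sum_congr rfl fun m _ => Finset.sum_comm).trans Finset.sum_comm
    _ ≤ ∑ g ∈ Finset.Icc 1 M, M * H * (1 / g) := by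
        refine Finset.sum_le_sum fun g hg => ?_
        have hg1 := (Finset.mem_Icc.1 hg).1
        have hg0 : (0:ℝ) < g := by exact_mod_cast hg1
        simp only [← Finset.mul_sum]
        rw [← Finset.sum_mul, ← Finset.sum_filter, ← Finset.sum_filter, Finset.sum_const,
          nsmul_eq_mul, mul_one]
        calc (g:ℝ) * ((((Finset.Icc 1 M).filter (g ∣ ·)).card : ℝ) *
              ∑ n ∈ (Finset.Icc 1 M).filter (g ∣ ·), (1 / (n:ℝ)))
            ≤ g * (M / g * (1 / g * H)) := by
              gcongr
              · exact card_filter_dvd_le M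
              · exact sum_inv_filter_dvd_le hg1 M
          _ = M * H * (1 / g) := by field_simp
    _ = M * H ^ 2 := by rw [← Finset.mul_sum, ← hH]; ring
    _ ≤ M * (1 + Real.log M) ^ 2 := by
        gcongr
        exact sum_inv_le_one_add_log M

theorem integral_sq_sum_arcDisc_le (h γ : ℝ) (M : ℕ) :
    ∫ θ in (0:ℝ)..1, (∑ m ∈ Finset.Icc 1 M, arcDisc h (m * θ + γ)) ^ 2 ≤
      M * (1 + Real.log M) ^ 2 := by
  have hint : ∀ m n : ℕ, IntervalIntegrable
      (fun θ : ℝ => arcDisc h (m * θ + γ) * arcDisc h (n * θ + γ)) volume 0 1 := by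
    intro m n
    refine intervalIntegrable_of_measurable_of_abs_le (K := 1) ?_ (fun t => ?_) _ _
    · exact ((measurable_arcDisc h).comp (by fun_prop)).mul ((measurable_arcDisc h).comp (by fun_prop))
    · rw [abs_mul]
      exact mul_le_one₀ (abs_arcDisc_le_one _ _) (abs_nonneg _) (abs_arcDisc_le_one _ _)
  have hexp : ∀ θ : ℝ, (∑ m ∈ Finset.Icc 1 M, arcDisc h (m * θ + γ)) ^ 2 =
      ∑ m ∈ Finset.Icc 1 M, ∑ n ∈ Finset.Icc 1 M,
        arcDisc h (m * θ + γ) * arcDisc h (n * θ + γ) := fun θ => by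
    rw [sq, Finset.sum_mul_sum]
  simp only [hexp]
  have hint' : ∀ m : ℕ, IntervalIntegrable (fun θ : ℝ => ∑ n ∈ Finset.Icc 1 M,
      arcDisc h (m * θ + γ) * arcDisc h (n * θ + γ)) volume 0 1 := by
    intro m
    have := IntervalIntegrable.sum (Finset.Icc 1 M) fun n _ => hint m n
    rwa [Finset.sum_fn] at this
  rw [intervalIntegral.integral_finsetSum fun m _ => hint' m]
  refine le_trans (Finset.sum_le_sum fun m _ => ?_) (sum_gcd_div_le M)
  rw [intervalIntegral.integral_finsetSum fun n _ => hint m n]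
  exact Finset.sum_le_sum fun n hn =>
    (le_abs_self _).trans (abs_integral_arcDisc_mul_arcDisc_le h γ (Finset.mem_Icc.1 hn).1)

theorem integral_le_of_periodic {G : ℝ → ℝ} (hG : Function.Periodic G 1) (hG0 : ∀ t, 0 ≤ G t)
    (hint : ∀ a b, IntervalIntegrable G volume a b) {a b : ℝ} (hab : a ≤ b) :
    ∫ t in a..b, G t ≤ (b - a + 1) * ∫ t in (0:ℝ)..1, G t := by
  have h1 : ∫ t in a..b, G t ≤ ∫ t in a..(a + ⌈b - a⌉₊), G t := by
    have := Nat.le_ceil (b - a)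
    refine intervalIntegral.integral_mono_interval le_rfl hab (by linarith)
      (Eventually.of_forall hG0) (hint _ _)
  have h2 : ∫ t in a..(a + ⌈b - a⌉₊), G t = ⌈b - a⌉₊ * ∫ t in (0:ℝ)..1, G t := by
    have := hG.intervalIntegral_add_zsmul_eq ⌈b - a⌉₊ a hint
    simp only [zsmul_eq_mul, mul_one, Int.cast_natCast] at this
    rw [this, hG.intervalIntegral_add_eq a 0, zero_add]
  rw [h2] at h1
  refine h1.trans (mul_le_mul_of_nonneg_right (Nat.ceil_lt_add_one (by linarith)).le ?_)
  exact intervalIntegral.integral_nonneg zero_le_one fun t _ => hG0 t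

theorem integral_sq_sum_arcDisc_scaled_le {a b : ℝ} (hab : a ≤ b) (β : ℝ) {d e : ℕ} (hd : 0 < d)
    (he : 0 < e) (M : ℕ) :
    ∫ α in a..b, (∑ m ∈ Finset.Icc 1 M, arcDisc (1 / e) ((α * (d * m : ℕ) + β) / e)) ^ 2 ≤
      (b - a + e) * (M * (1 + Real.log M) ^ 2) := by
  have hd' : (1:ℝ) ≤ d := by exact_mod_cast hd
  have he' : (0:ℝ) < e := by exact_mod_cast he
  set G : ℝ → ℝ := fun θ => (∑ m ∈ Finset.Icc 1 M, arcDisc (1 / e) (m * θ + β / e)) ^ 2 with hG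
  have hper : Function.Periodic G 1 := by
    intro θ
    simp only [hG]
    congr 1
    refine Finset.sum_congr rfl fun m _ => ?_
    rw [← arcDisc_add_intCast _ (m * θ + β / e) m]
    congr 1
    push_cast
    ring
  have hGm : Measurable G :=
    (Finset.measurable_sum _ fun m _ => (measurable_arcDisc _).comp (by fun_prop)).pow_const 2
  have hG1 : ∀ t, |G t| ≤ (M:ℝ) ^ 2 := by
    intro t
    rw [hG, abs_pow]
    refine pow_le_pow_left₀ (abs_nonneg _) ?_ 2
    refine (Finset.abs_sum_le_sum_abs _ _).trans ?_
    refine (Finset.sum_le_card_nsmul _ _ 1 fun m _ => abs_arcDisc_le_one _ _).trans ?_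
    simp
  have hint := intervalIntegrable_of_measurable_of_abs_le hGm hG1
  have hcov : ∀ α : ℝ,
      (∑ m ∈ Finset.Icc 1 M, arcDisc (1 / e) ((α * (d * m : ℕ) + β) / e)) ^ 2 =
      G (α * (d / e)) := by
    intro α
    simp only [hG]
    congr 1
    refine Finset.sum_congr rfl fun m _ => ?_
    congr 1
    push_cast
    ring
  simp only [hcov]
  rw [intervalIntegral.integral_comp_mul_right G (by positivity : (d / e : ℝ) ≠ 0), smul_eq_mul,
    inv_div]
  have h1 := integral_le_of_periodic hper (fun t => sq_nonneg _) hint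
    (a := a * (d / e)) (b := b * (d / e)) (by gcongr)
  have h2 := integral_sq_sum_arcDisc_le (1 / e) (β / e) M
  have h0 : 0 ≤ (M * (1 + Real.log M) ^ 2 : ℝ) := by positivity
  have hw : 0 ≤ b * (d / e : ℝ) - a * (d / e) + 1 := by
    have : a * (d / e : ℝ) ≤ b * (d / e) := by gcongr
    linarith
  calc (e / d : ℝ) * ∫ t in a * (d / e : ℝ)..b * (d / e : ℝ), G t
      ≤ (e / d : ℝ) * ((b * (d / e) - a * (d / e) + 1) * (M * (1 + Real.log M) ^ 2)) := by
        gcongr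
        exact h1.trans (mul_le_mul_of_nonneg_left h2 hw)
    _ = (b - a + e / d) * (M * (1 + Real.log M) ^ 2) := by
        field_simp
    _ ≤ _ := by
        gcongr
        exact div_le_self he'.le hd'

/-- The number of `1 ≤ n ≤ N` with `d ∣ n` and `e ∣ ⌊α n + β⌋`, minus its expected value. -/
noncomputable def sieveErr (α β : ℝ) (N d e : ℕ) : ℝ :=
  ∑ n ∈ Finset.Icc 1 N, (if d ∣ n then 1 else 0) * (if (e : ℤ) ∣ ⌊α * n + β⌋ then 1 else 0) -
    (N : ℝ) / (d * e)

theorem measurable_sieveErr (β : ℝ) (N d e : ℕ) : Measurable fun α => sieveErr α β N d e := by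
  unfold sieveErr
  refine (Finset.measurable_sum _ fun n _ => Measurable.const_mul ?_ _).sub_const _
  have h1 : Measurable fun α : ℝ => ⌊α * n + β⌋ := by fun_prop
  exact (measurable_of_countable fun z : ℤ => if (e : ℤ) ∣ z then (1:ℝ) else 0).comp h1

theorem abs_sieveErr_le (α β : ℝ) (N : ℕ) {d e : ℕ} (hd : 0 < d) (he : 0 < e) :
    |sieveErr α β N d e| ≤
      |∑ m ∈ Finset.Icc 1 (N / d), arcDisc (1 / e) ((α * (d * m : ℕ) + β) / e)| + 1 := by
  have he' : (1:ℝ) ≤ e := by exact_mod_cast he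
  have hd' : (0:ℝ) < d := by exact_mod_cast hd
  have h1 : ∑ n ∈ Finset.Icc 1 N,
      (if d ∣ n then (1:ℝ) else 0) * (if (e : ℤ) ∣ ⌊α * n + β⌋ then 1 else 0) =
      ∑ m ∈ Finset.Icc 1 (N / d), (if (e : ℤ) ∣ ⌊α * (d * m : ℕ) + β⌋ then (1:ℝ) else 0) := by
    simp only [ite_mul, one_mul, zero_mul]
    rw [← Finset.sum_filter]
    symm
    refine Finset.sum_bij (fun m _ => d * m) ?_ ?_ ?_ ?_
    · intro m hm
      rw [Finset.mem_Icc, Nat.le_div_iff_mul_le hd] at hm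
      simp only [Finset.mem_filter, Finset.mem_Icc]
      exact ⟨⟨Nat.mul_pos hd hm.1, by linarith [hm.2, mul_comm m d]⟩, Dvd.intro _ rfl⟩
    · intro i _ j _ h
      exact Nat.eq_of_mul_eq_mul_left hd h
    · intro n hn
      simp only [Finset.mem_filter, Finset.mem_Icc] at hn
      obtain ⟨⟨h1, h2⟩, m, rfl⟩ := hn
      refine ⟨m, ?_, rfl⟩
      rw [Finset.mem_Icc, Nat.le_div_iff_mul_le hd]
      exact ⟨Nat.pos_of_mul_pos_left h1, by linarith [mul_comm m d]⟩
    · intros; rfl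
  have h2 : ∑ m ∈ Finset.Icc 1 (N / d), arcDisc (1 / e) ((α * (d * m : ℕ) + β) / e) =
      ∑ m ∈ Finset.Icc 1 (N / d), (if (e : ℤ) ∣ ⌊α * (d * m : ℕ) + β⌋ then (1:ℝ) else 0) -
        (N / d : ℕ) * (1 / e) := by
    rw [Finset.sum_congr rfl fun m _ => arcDisc_inv_floor e he _, Finset.sum_sub_distrib]
    simp
  have h3 : sieveErr α β N d e =
      ∑ m ∈ Finset.Icc 1 (N / d), arcDisc (1 / e) ((α * (d * m : ℕ) + β) / e) +
        ((N / d : ℕ) - (N : ℝ) / d) / e := by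
    rw [sieveErr, h1, h2]
    field_simp
    ring
  rw [h3]
  refine (abs_add_le _ _).trans (add_le_add le_rfl ?_)
  rw [abs_div, abs_of_pos (by linarith : (0:ℝ) < e)]
  refine div_le_one_of_le₀ (le_trans ?_ he') (by linarith)
  rw [← Nat.floor_div_eq_div (K := ℝ) N d, abs_le]
  have h4 := Nat.floor_le (by positivity : (0:ℝ) ≤ (N : ℝ) / d)
  have h5 := Nat.lt_floor_add_one ((N : ℝ) / d)
  constructor <;> linarith

theorem abs_sieveErr_le_const (α β : ℝ) (N : ℕ) {d e : ℕ} (hd : 0 < d) (he : 0 < e) :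
    |sieveErr α β N d e| ≤ (N / d : ℕ) + 1 := by
  refine (abs_sieveErr_le α β N hd he).trans (add_le_add ?_ le_rfl)
  refine (Finset.abs_sum_le_sum_abs _ _).trans ?_
  refine (Finset.sum_le_card_nsmul _ _ 1 fun m _ => abs_arcDisc_le_one _ _).trans ?_
  simp

theorem intervalIntegrable_abs_sieveErr (β : ℝ) (N : ℕ) {d e : ℕ} (hd : 0 < d) (he : 0 < e)
    (a b : ℝ) : IntervalIntegrable (fun α => |sieveErr α β N d e|) volume a b :=
  intervalIntegrable_of_measurable_of_abs_le (measurable_sieveErr β N d e).abs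
    (fun α => (abs_abs _).trans_le (abs_sieveErr_le_const α β N hd he)) a b

theorem integral_abs_sieveErr_le {a b : ℝ} (hab : a ≤ b) (β : ℝ) (N : ℕ) {d e : ℕ} (hd : 0 < d)
    (he : 0 < e) {T : ℝ} (hT : 0 < T) :
    ∫ α in a..b, |sieveErr α β N d e| ≤
      (b - a + e) * (N * (1 + Real.log N) ^ 2) / T + (b - a) * (T + 1) := by
  set S : ℝ → ℝ := fun α =>
    ∑ m ∈ Finset.Icc 1 (N / d), arcDisc (1 / e) ((α * (d * m : ℕ) + β) / e) with hS
  have hSm : Measurable S :=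
    Finset.measurable_sum _ fun m _ => (measurable_arcDisc _).comp (by fun_prop)
  have hS1 : ∀ α, |S α ^ 2 / T| ≤ ((N / d : ℕ) : ℝ) ^ 2 / T := by
    intro α
    rw [abs_div, abs_of_pos hT, abs_pow]
    gcongr
    refine (Finset.abs_sum_le_sum_abs _ _).trans ?_
    refine (Finset.sum_le_card_nsmul _ _ 1 fun m _ => abs_arcDisc_le_one _ _).trans ?_
    simp
  have hSint : IntervalIntegrable (fun α => S α ^ 2 / T) volume a b :=
    intervalIntegrable_of_measurable_of_abs_le ((hSm.pow_const 2).div_const T) hS1 a b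
  have hpt : ∀ α, |sieveErr α β N d e| ≤ S α ^ 2 / T + (T + 1) := by
    intro α
    refine (abs_sieveErr_le α β N hd he).trans ?_
    rw [← add_assoc]
    refine add_le_add ?_ le_rfl
    rw [← sub_le_iff_le_add, le_div_iff₀ hT, ← sq_abs (S α)]
    change (|S α| - T) * T ≤ _
    nlinarith [sq_nonneg (|S α| - T), abs_nonneg (S α), sq_nonneg T, mul_nonneg (abs_nonneg (S α)) hT.le]
  have h1 : ∫ α in a..b, |sieveErr α β N d e| ≤ ∫ α in a..b, (S α ^ 2 / T + (T + 1)) :=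
    intervalIntegral.integral_mono_on hab (intervalIntegrable_abs_sieveErr β N hd he a b)
      (hSint.add intervalIntegrable_const) fun α _ => hpt α
  refine h1.trans ?_
  rw [intervalIntegral.integral_add hSint intervalIntegrable_const,
    intervalIntegral.integral_const, smul_eq_mul, intervalIntegral.integral_div]
  have hNd : ((N / d : ℕ) : ℝ) * (1 + Real.log (N / d : ℕ)) ^ 2 ≤ N * (1 + Real.log N) ^ 2 := by
    rcases Nat.eq_zero_or_pos (N / d) with h | h
    · rw [h]
      simp
      positivity
    · have hle : ((N / d : ℕ) : ℝ) ≤ N := by exact_mod_cast Nat.div_le_self N d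
      have h0 : (0:ℝ) < (N / d : ℕ) := by exact_mod_cast h
      have hl : 0 ≤ Real.log (N / d : ℕ) := Real.log_nonneg (by exact_mod_cast h)
      gcongr
  have hba : 0 ≤ b - a := by linarith
  gcongr
  exact (integral_sq_sum_arcDisc_scaled_le hab β hd he (N / d)).trans (by gcongr)

/-- The pairs of indices occurring in the square of a sum over `1 ≤ d ≤ z`. -/
def levelPairs (z : ℕ) : Finset (ℕ × ℕ) := Finset.Icc 1 z ×ˢ Finset.Icc 1 z

/-- The product of the Selberg weights of a pair of indices. -/
noncomputable def pairWeight (z : ℕ) (p : ℕ × ℕ) : ℝ := selbergWeight z p.1 * selbergWeight z p.2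

theorem abs_pairWeight_le {z : ℕ} {p : ℕ × ℕ} (hp : p ∈ levelPairs z) :
    |pairWeight z p| ≤ (z:ℝ) ^ 4 := by
  rw [levelPairs, Finset.mem_product, Finset.mem_Icc, Finset.mem_Icc] at hp
  rw [pairWeight, abs_mul, show (z:ℝ) ^ 4 = z ^ 2 * z ^ 2 by ring]
  exact mul_le_mul (abs_selbergWeight_le hp.1.2) (abs_selbergWeight_le hp.2.2) (abs_nonneg _)
    (by positivity)

theorem lcm_pos_of_mem_levelPairs {z : ℕ} {p : ℕ × ℕ} (hp : p ∈ levelPairs z) :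
    0 < Nat.lcm p.1 p.2 := by
  rw [levelPairs, Finset.mem_product, Finset.mem_Icc, Finset.mem_Icc] at hp
  exact Nat.lcm_pos hp.1.1 hp.2.1

theorem lcm_le_of_mem_levelPairs {z : ℕ} {p : ℕ × ℕ} (hp : p ∈ levelPairs z) :
    (Nat.lcm p.1 p.2 : ℝ) ≤ (z:ℝ) ^ 2 := by
  rw [levelPairs, Finset.mem_product, Finset.mem_Icc, Finset.mem_Icc] at hp
  have h := Nat.le_of_dvd (Nat.mul_pos hp.1.1 hp.2.1) (Nat.lcm_dvd_mul p.1 p.2)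
  have h2 := Nat.mul_le_mul hp.1.2 hp.2.2
  rw [sq]
  exact_mod_cast h.trans h2

theorem sum_pairWeight_div_lcm (z : ℕ) :
    ∑ p ∈ levelPairs z, pairWeight z p / Nat.lcm p.1 p.2 = selbergForm z := by
  rw [levelPairs, Finset.sum_product]
  rfl

theorem sq_sum_selbergWeight (z : ℕ) (m : ℤ) :
    (∑ d ∈ Finset.Icc 1 z, if (d : ℤ) ∣ m then selbergWeight z d else 0) ^ 2 =
      ∑ p ∈ levelPairs z, pairWeight z p * (if (Nat.lcm p.1 p.2 : ℤ) ∣ m then 1 else 0) := by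
  rw [sq, Finset.sum_mul_sum, levelPairs, Finset.sum_product]
  refine Finset.sum_congr rfl fun d _ => Finset.sum_congr rfl fun e _ => ?_
  have h : ((Nat.lcm d e : ℕ) : ℤ) ∣ m ↔ (d : ℤ) ∣ m ∧ (e : ℤ) ∣ m := by
    simp only [Int.natCast_dvd, Nat.lcm_dvd_iff]
  simp only [h, pairWeight]
  by_cases h1 : (d : ℤ) ∣ m <;> by_cases h2 : (e : ℤ) ∣ m <;> simp [h1, h2]

theorem sq_sum_selbergWeight_prime {z q : ℕ} (hz : 1 ≤ z) (hq : q.Prime) (hzq : z < q) :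
    (∑ d ∈ Finset.Icc 1 z, if (d : ℤ) ∣ (q : ℤ) then selbergWeight z d else 0) ^ 2 = 1 := by
  rw [Finset.sum_eq_single 1]
  · simp [selbergWeight_one hz]
  · intro d hd hd1
    rw [Finset.mem_Icc] at hd
    rw [if_neg]
    intro h
    rcases (Nat.dvd_prime hq).1 (by exact_mod_cast h) with h | h <;> omega
  · intro h
    exact absurd (Finset.mem_Icc.2 ⟨le_rfl, hz⟩) h

theorem piStar_natCast_le {α β b₁ : ℝ} (hb : 0 < b₁) (hα : b₁ < α) {z : ℕ} (hz : 1 ≤ z) (N : ℕ) :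
    (piStar α β N : ℝ) ≤ (z + (z + 1 + |β|) / b₁) + N * selbergForm z ^ 2 +
      ∑ p ∈ levelPairs z, ∑ q ∈ levelPairs z,
        (z:ℝ) ^ 8 * |sieveErr α β N (Nat.lcm p.1 p.2) (Nat.lcm q.1 q.2)| := by
  classical
  set W : ℝ := z + (z + 1 + |β|) / b₁ with hW
  have hW0 : 0 ≤ (z + 1 + |β|) / b₁ := by positivity
  let A : ℤ → ℝ := fun m => (∑ d ∈ Finset.Icc 1 z, if (d : ℤ) ∣ m then selbergWeight z d else 0) ^ 2
  have hA0 : ∀ m, 0 ≤ A m := fun m => sq_nonneg _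
  have h1 : (piStar α β N : ℝ) ≤ ∑ n ∈ Finset.Icc 1 N,
      ((if (n:ℝ) ≤ W then 1 else 0) + A n * A ⌊α * n + β⌋) := by
    rw [piStar_natCast, Finset.sum_filter]
    refine Finset.sum_le_sum fun n hn => ?_
    have hnn : 0 ≤ (if (n:ℝ) ≤ W then (1:ℝ) else 0) := by positivity
    have hAA := mul_nonneg (hA0 n) (hA0 ⌊α * n + β⌋)
    split_ifs with hp hnW
    · have : (primeFloorSet β n).indicator (1 : ℝ → ℝ) α ≤ 1 :=
        Set.indicator_le_self' (fun _ _ => zero_le_one) _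
      linarith
    · rw [Set.indicator_apply]
      split_ifs with hmem
      · have hmem' : Nat.Prime (⌊α * n + β⌋).toNat := hmem
        have hfl : ((⌊α * n + β⌋.toNat : ℕ) : ℤ) = ⌊α * n + β⌋ := by
          apply Int.toNat_of_nonneg
          by_contra! h
          rw [Int.toNat_of_nonpos h.le] at hmem'
          exact Nat.not_prime_zero hmem'
        have hnz : z < n := by
          have : (z:ℝ) < n := by linarith
          exact_mod_cast this
        have hqz : z < ⌊α * n + β⌋.toNat := by
          by_contra! h
          have h2 : ⌊α * n + β⌋ < (z:ℤ) + 1 := by omega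
          have h3 : α * n + β < z + 1 := by
            rw [Int.floor_lt] at h2
            exact_mod_cast h2
          apply hnW
          have hn0 : (0:ℝ) ≤ n := n.cast_nonneg
          have h4 : (n:ℝ) ≤ (z + 1 + |β|) / b₁ := by
            rw [le_div_iff₀ hb]
            nlinarith [neg_abs_le β]
          have hz0 : (0:ℝ) ≤ z := z.cast_nonneg
          linarith
        have e1 : A n = 1 := sq_sum_selbergWeight_prime hz hp hnz
        have e2 : A ⌊α * n + β⌋ = 1 := by
          rw [← hfl]
          exact sq_sum_selbergWeight_prime hz hmem' hqz
        rw [e1, e2]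
        norm_num
      · linarith
    · linarith
    · linarith
  have h2 : ∑ n ∈ Finset.Icc 1 N, (if (n:ℝ) ≤ W then (1:ℝ) else 0) ≤ W := by
    rw [← Finset.sum_filter, Finset.sum_const, nsmul_eq_mul, mul_one]
    have hz0 : (0:ℝ) ≤ z := z.cast_nonneg
    have hW0 : 0 ≤ W := by linarith
    refine le_trans ?_ (Nat.floor_le hW0)
    have hsub : (Finset.Icc 1 N).filter (fun n : ℕ => (n:ℝ) ≤ W) ⊆ Finset.Icc 1 ⌊W⌋₊ := by
      intro n hn
      simp only [Finset.mem_filter, Finset.mem_Icc] at hn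
      exact Finset.mem_Icc.2 ⟨hn.1.1, Nat.le_floor hn.2⟩
    exact_mod_cast (Finset.card_le_card hsub).trans (by simp)
  have h3 : ∑ n ∈ Finset.Icc 1 N, A n * A ⌊α * n + β⌋ =
      ∑ p ∈ levelPairs z, ∑ q ∈ levelPairs z, pairWeight z p * pairWeight z q *
        (N / (Nat.lcm p.1 p.2 * Nat.lcm q.1 q.2) +
          sieveErr α β N (Nat.lcm p.1 p.2) (Nat.lcm q.1 q.2)) := by
    simp only [A, sq_sum_selbergWeight, Finset.sum_mul_sum, sieveErr, add_sub_cancel]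
    rw [Finset.sum_comm]
    refine Finset.sum_congr rfl fun p _ => ?_
    rw [Finset.sum_comm]
    refine Finset.sum_congr rfl fun q _ => ?_
    rw [Finset.mul_sum]
    refine Finset.sum_congr rfl fun n _ => ?_
    simp only [Int.natCast_dvd_natCast]
    ring
  have h4 : ∑ p ∈ levelPairs z, ∑ q ∈ levelPairs z, pairWeight z p * pairWeight z q *
        ((N:ℝ) / (Nat.lcm p.1 p.2 * Nat.lcm q.1 q.2)) = N * selbergForm z ^ 2 := by
    rw [← sum_pairWeight_div_lcm, sq, Finset.sum_mul_sum, Finset.mul_sum]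
    refine Finset.sum_congr rfl fun p _ => ?_
    rw [Finset.mul_sum]
    refine Finset.sum_congr rfl fun q _ => ?_
    rw [div_mul_div_comm]
    ring
  rw [Finset.sum_add_distrib, h3] at h1
  simp only [mul_add, Finset.sum_add_distrib] at h1
  rw [h4] at h1
  have h5 : ∑ p ∈ levelPairs z, ∑ q ∈ levelPairs z, pairWeight z p * pairWeight z q *
        sieveErr α β N (Nat.lcm p.1 p.2) (Nat.lcm q.1 q.2) ≤
      ∑ p ∈ levelPairs z, ∑ q ∈ levelPairs z,
        (z:ℝ) ^ 8 * |sieveErr α β N (Nat.lcm p.1 p.2) (Nat.lcm q.1 q.2)| := by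
    refine Finset.sum_le_sum fun p hp => Finset.sum_le_sum fun q hq => ?_
    refine (le_abs_self _).trans ?_
    rw [abs_mul, abs_mul, show (z:ℝ) ^ 8 = z ^ 4 * z ^ 4 by ring]
    gcongr
    · exact abs_pairWeight_le hp
    · exact abs_pairWeight_le hq
  linarith

/-- The error term in the upper bound sieve for `piStar α β (k ^ 100)` of level `k`. -/
noncomputable def majorantErr (b₁ β : ℝ) (k : ℕ) (α : ℝ) : ℝ :=
  Real.log (k ^ 100 : ℕ) ^ 2 / (k ^ 100 : ℕ) * ((k + (k + 1 + |β|) / b₁) +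
    ∑ p ∈ levelPairs k, ∑ q ∈ levelPairs k,
      (k:ℝ) ^ 8 * |sieveErr α β (k ^ 100) (Nat.lcm p.1 p.2) (Nat.lcm q.1 q.2)|)

theorem piStar_mul_log_sq_div_le {α β b₁ : ℝ} (hb : 0 < b₁) (hα : b₁ < α) {k : ℕ} (hk : 1 ≤ k) :
    (piStar α β (k ^ 100 : ℕ) : ℝ) * Real.log (k ^ 100 : ℕ) ^ 2 / (k ^ 100 : ℕ) ≤
      40000 + majorantErr b₁ β k α := by
  have h := piStar_natCast_le (β := β) hb hα hk (k ^ 100)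
  have hN : (0:ℝ) < (k ^ 100 : ℕ) := by exact_mod_cast Nat.pow_pos hk
  have hl : Real.log (k ^ 100 : ℕ) = 100 * Real.log k := by
    push_cast
    rw [Real.log_pow]
    norm_num
  have hQ := selbergForm_mul_log_le hk
  have hQ0 : 0 ≤ selbergForm k * Real.log k :=
    mul_nonneg (selbergForm_nonneg k) (Real.log_nonneg (by exact_mod_cast hk))
  have hmain : selbergForm k ^ 2 * Real.log (k ^ 100 : ℕ) ^ 2 ≤ 40000 := by
    rw [hl]
    nlinarith
  rw [mul_div_assoc]
  refine (mul_le_mul_of_nonneg_right h (by positivity)).trans ?_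
  rw [majorantErr]
  have e : ((k ^ 100 : ℕ) : ℝ) * selbergForm k ^ 2 *
      (Real.log (k ^ 100 : ℕ) ^ 2 / (k ^ 100 : ℕ)) =
      selbergForm k ^ 2 * Real.log (k ^ 100 : ℕ) ^ 2 := by
    field_simp
  rw [add_right_comm, add_mul, e]
  linarith

theorem intervalIntegrable_sum_sum_sieveErr (β : ℝ) (k N : ℕ) (a b : ℝ) :
    IntervalIntegrable (fun α => ∑ p ∈ levelPairs k, ∑ q ∈ levelPairs k,
      (k:ℝ) ^ 8 * |sieveErr α β N (Nat.lcm p.1 p.2) (Nat.lcm q.1 q.2)|) volume a b := by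
  have h : ∀ p ∈ levelPairs k, IntervalIntegrable (fun α => ∑ q ∈ levelPairs k,
      (k:ℝ) ^ 8 * |sieveErr α β N (Nat.lcm p.1 p.2) (Nat.lcm q.1 q.2)|) volume a b := by
    intro p hp
    have := IntervalIntegrable.sum (levelPairs k) fun q hq =>
      (intervalIntegrable_abs_sieveErr β N (lcm_pos_of_mem_levelPairs hp)
        (lcm_pos_of_mem_levelPairs hq) a b).const_mul ((k:ℝ) ^ 8)
    rwa [Finset.sum_fn] at this
  have := IntervalIntegrable.sum (levelPairs k) h
  rwa [Finset.sum_fn] at this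

theorem integral_sum_sum_sieveErr_le {a b : ℝ} (hab : a ≤ b) (β : ℝ) (k N : ℕ) {T : ℝ}
    (hT : 0 < T) :
    ∫ α in a..b, ∑ p ∈ levelPairs k, ∑ q ∈ levelPairs k,
      (k:ℝ) ^ 8 * |sieveErr α β N (Nat.lcm p.1 p.2) (Nat.lcm q.1 q.2)| ≤
    (k:ℝ) ^ 12 * ((b - a + k ^ 2) * (N * (1 + Real.log N) ^ 2) / T + (b - a) * (T + 1)) := by
  have hint : ∀ p ∈ levelPairs k, ∀ q ∈ levelPairs k, IntervalIntegrable (fun α =>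
      (k:ℝ) ^ 8 * |sieveErr α β N (Nat.lcm p.1 p.2) (Nat.lcm q.1 q.2)|) volume a b :=
    fun p hp q hq => (intervalIntegrable_abs_sieveErr β N (lcm_pos_of_mem_levelPairs hp)
        (lcm_pos_of_mem_levelPairs hq) a b).const_mul ((k:ℝ) ^ 8)
  have hint' : ∀ p ∈ levelPairs k, IntervalIntegrable (fun α => ∑ q ∈ levelPairs k,
      (k:ℝ) ^ 8 * |sieveErr α β N (Nat.lcm p.1 p.2) (Nat.lcm q.1 q.2)|) volume a b := by
    intro p hp
    have := IntervalIntegrable.sum (levelPairs k) (hint p hp)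
    rwa [Finset.sum_fn] at this
  set R := (b - a + (k:ℝ) ^ 2) * (N * (1 + Real.log N) ^ 2) / T + (b - a) * (T + 1) with hR
  have hcard : ((levelPairs k).card : ℝ) = (k:ℝ) ^ 2 := by
    simp [levelPairs, sq]
  rw [intervalIntegral.integral_finsetSum hint']
  refine (Finset.sum_le_card_nsmul _ _ ((k:ℝ) ^ 10 * R) fun p hp => ?_).trans ?_
  · rw [intervalIntegral.integral_finsetSum (hint p hp)]
    refine (Finset.sum_le_card_nsmul _ _ ((k:ℝ) ^ 8 * R) fun q hq => ?_).trans ?_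
    · rw [intervalIntegral.integral_const_mul]
      gcongr
      refine (integral_abs_sieveErr_le hab β N (lcm_pos_of_mem_levelPairs hp)
        (lcm_pos_of_mem_levelPairs hq) hT).trans ?_
      rw [hR]
      gcongr
      exact lcm_le_of_mem_levelPairs hq
    · rw [nsmul_eq_mul, hcard]
      exact le_of_eq (by ring)
  · rw [nsmul_eq_mul, hcard]
    exact le_of_eq (by ring)

theorem intervalIntegrable_majorantErr (b₁ β : ℝ) (k : ℕ) (a b : ℝ) :
    IntervalIntegrable (majorantErr b₁ β k) volume a b :=
  (intervalIntegrable_const.add (intervalIntegrable_sum_sum_sieveErr β k _ a b)).const_mul _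

theorem majorantErr_nonneg {b₁ : ℝ} (hb : 0 < b₁) (β : ℝ) (k : ℕ) (α : ℝ) :
    0 ≤ majorantErr b₁ β k α := by
  unfold majorantErr
  positivity

theorem integral_majorantErr_le {a b b₁ : ℝ} (hb : 0 < b₁) (hab : a ≤ b) (β : ℝ) {k : ℕ}
    (hk : 1 ≤ k) :
    ∫ α in a..b, majorantErr b₁ β k α ≤
      10000 * ((b - a) * (1 + (2 + |β|) / b₁) + 10201 * (b - a + 1) + 2 * (b - a)) / k := by
  have hx : (1:ℝ) ≤ k := by exact_mod_cast hk
  have hba : 0 ≤ b - a := by linarith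
  have hlog : Real.log (k ^ 100 : ℕ) = 100 * Real.log k := by
    push_cast
    rw [Real.log_pow]
    norm_num
  have hlogk : Real.log k ≤ k := (Real.log_le_sub_one_of_pos (by linarith)).trans (by linarith)
  have hlogk0 : 0 ≤ Real.log k := Real.log_nonneg hx
  have h1 := integral_sum_sum_sieveErr_le hab β k (k ^ 100) (T := (k:ℝ) ^ 75) (by positivity)
  simp only [majorantErr]
  rw [intervalIntegral.integral_const_mul, intervalIntegral.integral_add intervalIntegrable_const
    (intervalIntegrable_sum_sum_sieveErr β k _ a b), intervalIntegral.integral_const, smul_eq_mul]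
  rw [hlog] at h1 ⊢
  have hN : ((k ^ 100 : ℕ) : ℝ) = (k:ℝ) ^ 100 := by push_cast; rfl
  rw [hN] at h1 ⊢
  set x : ℝ := (k:ℝ) with hxdef
  have hx0 : 0 < x := by linarith
  have hmono : ∀ {i j : ℕ}, i ≤ j → x ^ i ≤ x ^ j := fun h => pow_le_pow_right₀ hx h
  have e1 : (b - a) * (x + (x + 1 + |β|) / b₁) ≤ ((b - a) * (1 + (2 + |β|) / b₁)) * x ^ 87 := by
    have h2 : x + (x + 1 + |β|) / b₁ ≤ (1 + (2 + |β|) / b₁) * x := by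
      rw [add_mul, one_mul, div_mul_eq_mul_div]
      gcongr
      nlinarith [abs_nonneg β]
    have h3 : x ≤ x ^ 87 := by simpa using hmono (show 1 ≤ 87 by norm_num)
    rw [mul_assoc]
    refine mul_le_mul_of_nonneg_left (h2.trans ?_) hba
    gcongr
  have e2 : x ^ 12 * ((b - a + x ^ 2) * (x ^ 100 * (1 + 100 * Real.log k) ^ 2) / x ^ 75) ≤
      (10201 * (b - a + 1)) * x ^ 87 := by
    have h2 : 1 + 100 * Real.log k ≤ 101 * x := by linarith
    have h3 : b - a + x ^ 2 ≤ (b - a + 1) * x ^ 2 := by nlinarith [hmono (show 0 ≤ 2 by norm_num)]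
    calc _ ≤ x ^ 12 * (((b - a + 1) * x ^ 2) * (x ^ 100 * (101 * x) ^ 2) / x ^ 75) := by gcongr
      _ = (10201 * (b - a + 1)) * x ^ 41 := by
        rw [mul_div_assoc', div_eq_iff (by positivity)]
        ring
      _ ≤ _ := by
        exact mul_le_mul_of_nonneg_left (hmono (by norm_num)) (by positivity)
  have e3 : x ^ 12 * ((b - a) * (x ^ 75 + 1)) ≤ (2 * (b - a)) * x ^ 87 := by
    have := hmono (show 12 ≤ 87 by norm_num)
    calc x ^ 12 * ((b - a) * (x ^ 75 + 1)) = (b - a) * (x ^ 87 + x ^ 12) := by ring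
      _ ≤ (b - a) * (x ^ 87 + x ^ 87) := by gcongr
      _ = _ := by ring
  rw [mul_add] at h1
  set D := (b - a) * (1 + (2 + |β|) / b₁) + 10201 * (b - a + 1) + 2 * (b - a) with hD
  have hD0 : 0 ≤ D := by positivity
  have h2 : (b - a) * (x + (x + 1 + |β|) / b₁) +
      ∫ α in a..b, ∑ p ∈ levelPairs k, ∑ q ∈ levelPairs k,
        x ^ 8 * |sieveErr α β (k ^ 100) (Nat.lcm p.1 p.2) (Nat.lcm q.1 q.2)| ≤ D * x ^ 87 := by
    rw [hD, add_mul, add_mul]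
    linarith
  refine (mul_le_mul_of_nonneg_left h2 (by positivity)).trans ?_
  calc (100 * Real.log k) ^ 2 / x ^ 100 * (D * x ^ 87)
      ≤ (100 * x) ^ 2 / x ^ 100 * (D * x ^ 87) := by gcongr
    _ = 10000 * D / x ^ 11 := by
      rw [div_mul_eq_mul_div, div_eq_div_iff (by positivity) (by positivity)]
      ring
    _ ≤ 10000 * D / x := by
      gcongr
      simpa using hmono (show 1 ≤ 11 by norm_num)

theorem tendsto_integral_majorantErr {a b b₁ : ℝ} (hb : 0 < b₁) (hab : a ≤ b) (β : ℝ) :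
    Tendsto (fun k : ℕ => ∫ α in Set.Ioo a b, majorantErr b₁ β k α) atTop (nhds 0) := by
  have hconv : ∀ k : ℕ, ∫ α in Set.Ioo a b, majorantErr b₁ β k α =
      ∫ α in a..b, majorantErr b₁ β k α := fun k => by
    rw [intervalIntegral.integral_of_le hab, integral_Ioc_eq_integral_Ioo]
  simp only [hconv]
  have hlim : Tendsto (fun k : ℕ =>
      10000 * ((b - a) * (1 + (2 + |β|) / b₁) + 10201 * (b - a + 1) + 2 * (b - a)) / (k : ℝ))
      atTop (nhds 0) := tendsto_const_nhds.div_atTop tendsto_natCast_atTop_atTop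
  refine squeeze_zero' (Eventually.of_forall fun k =>
    intervalIntegral.integral_nonneg hab fun α _ => majorantErr_nonneg hb β k α) ?_ hlim
  filter_upwards [eventually_ge_atTop 1] with k hk
  exact integral_majorantErr_le hb hab β hk

/-- The normalised counting function `π*(x) (log x)² / x` at `x = k ^ 100`. -/
noncomputable def normalizedCount (β : ℝ) (k : ℕ) (α : ℝ) : ℝ :=
  (piStar α β (k ^ 100 : ℕ) : ℝ) * Real.log (k ^ 100 : ℕ) ^ 2 / (k ^ 100 : ℕ)

theorem measurable_normalizedCount (β : ℝ) (k : ℕ) : Measurable (normalizedCount β k) := by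
  unfold normalizedCount
  simp only [piStar_natCast]
  exact ((Finset.measurable_sum _ fun p _ =>
    measurable_one.indicator (measurableSet_primeFloorSet β p)).mul_const _).div_const _

theorem normalizedCount_nonneg (β : ℝ) (k : ℕ) (α : ℝ) : 0 ≤ normalizedCount β k α := by
  unfold normalizedCount
  positivity

theorem tendsto_natCast_pow_atTop :
    Tendsto (fun k : ℕ => ((k ^ 100 : ℕ) : ℝ)) atTop atTop :=
  tendsto_natCast_atTop_atTop.comp (tendsto_pow_atTop (by norm_num))

/-- The parameters in `(a, b)` at which the normalised count is at most `s` from `m` on. -/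
def smallCountSet (β a b s : ℝ) (m : ℕ) : Set ℝ :=
  Set.Ioo a b ∩ ⋂ k ≥ m, {α | normalizedCount β k α ≤ s}

theorem measurableSet_smallCountSet (β a b s : ℝ) (m : ℕ) :
    MeasurableSet (smallCountSet β a b s m) :=
  measurableSet_Ioo.inter (MeasurableSet.iInter fun k => MeasurableSet.iInter fun _ =>
    measurableSet_le (measurable_normalizedCount β k) measurable_const)

theorem monotone_smallCountSet (β a b s : ℝ) : Monotone (smallCountSet β a b s) := by
  intro m n hmn
  exact Set.inter_subset_inter_right _
    (Set.biInter_subset_biInter_left fun k hk => hmn.trans hk)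

theorem measure_smallCountSet_le {a b : ℝ} (ha : 0 < a) (hab : a < b) (β s : ℝ) (m : ℕ) :
    (40000 - s) * volume.real (smallCountSet β a b s m) ≤ 39999 * (b - a) := by
  set B := smallCountSet β a b s m with hB
  have hBsub : B ⊆ Set.Ioo a b := Set.inter_subset_left
  have hrint : ∀ k, IntegrableOn (majorantErr a β k) (Set.Ioo a b) := fun k =>
    ((intervalIntegrable_iff_integrableOn_Ioc_of_le hab.le).1
      (intervalIntegrable_majorantErr a β k a b)).mono_set Set.Ioo_subset_Ioc_self
  have hBint : IntegrableOn (B.indicator (1 : ℝ → ℝ)) (Set.Ioo a b) :=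
    (integrable_const (1:ℝ)).indicator (measurableSet_smallCountSet β a b s m)
  have hupper : ∀ᶠ k : ℕ in atTop, (40000 - s) * volume.real B ≤
      40000 * (b - a) + (∫ α in Set.Ioo a b, majorantErr a β k α) -
        ∫ α in Set.Ioo a b, normalizedCount β k α := by
    filter_upwards [eventually_ge_atTop m, eventually_ge_atTop 1] with k hkm hk1
    have hpt : ∀ α ∈ Set.Ioo a b, normalizedCount β k α ≤
        (40000 + majorantErr a β k α) - (40000 - s) * B.indicator 1 α := by
      intro α hα
      by_cases hmem : α ∈ B
      · have h1 : normalizedCount β k α ≤ s := (Set.mem_iInter₂.1 hmem.2) k hkm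
        rw [Set.indicator_of_mem hmem, Pi.one_apply]
        linarith [majorantErr_nonneg ha β k α]
      · rw [Set.indicator_of_notMem hmem, mul_zero, sub_zero]
        exact piStar_mul_log_sq_div_le ha hα.1 hk1
    have hmaj : IntegrableOn (fun α => 40000 + majorantErr a β k α) (Set.Ioo a b) :=
      (integrable_const (40000:ℝ)).add (hrint k)
    have hmaj' := hmaj.sub (hBint.const_mul (40000 - s))
    have h1 : ∫ α in Set.Ioo a b, normalizedCount β k α ≤
        ∫ α in Set.Ioo a b, ((40000 + majorantErr a β k α) - (40000 - s) * B.indicator 1 α) := by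
      refine integral_mono_of_nonneg (Eventually.of_forall fun α => normalizedCount_nonneg β k α)
        hmaj' ?_
      filter_upwards [ae_restrict_mem measurableSet_Ioo] with α hα
      exact hpt α hα
    rw [integral_sub hmaj (hBint.const_mul (40000 - s)),
      integral_add (integrable_const (40000:ℝ)) (hrint k), integral_const_mul,
      integral_indicator_one (measurableSet_smallCountSet β a b s m),
      measureReal_restrict_apply (measurableSet_smallCountSet β a b s m),
      Set.inter_eq_left.2 hBsub, setIntegral_const, Real.volume_real_Ioo_of_le hab.le,
      smul_eq_mul] at h1
    linarith
  refine le_of_forall_pos_le_add fun δ hδ => ?_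
  have hba : 0 < b - a := by linarith
  have hpow : Tendsto (fun k : ℕ => k ^ 100) atTop atTop := tendsto_pow_atTop (by norm_num)
  have hlower := hpow.eventually
    (eventually_le_integral_piStar ha hab β (ε := δ / 2 / (b - a)) (by positivity))
  have herr := (tendsto_integral_majorantErr ha hab.le β).eventually_lt_const (half_pos hδ)
  obtain ⟨k, h1, h2, h3⟩ := (hupper.and (hlower.and herr)).exists
  have h4 : ∫ α in Set.Ioo a b, normalizedCount β k α =
      (∫ α in Set.Ioo a b, (piStar α β (k ^ 100 : ℕ) : ℝ)) * Real.log (k ^ 100 : ℕ) ^ 2 /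
        (k ^ 100 : ℕ) := by
    simp only [normalizedCount]
    rw [integral_div, integral_mul_const]
  rw [← h4] at h2
  have h5 : (1 - δ / 2 / (b - a)) * (b - a) = (b - a) - δ / 2 := by field_simp
  rw [h5] at h2
  linarith

/-- The parameters at which the upper limit of `π*(x) (log x)² / x` is at most `c`. -/
def limsupLeSet (β c : ℝ) : Set ℝ :=
  {α | Filter.limsup
    (fun x : ℝ => (((piStar α β x : ℝ) * (Real.log x) ^ 2 / x : ℝ) : EReal)) Filter.atTop ≤
      (c : EReal)}

theorem measure_limsupLeSet_inter_Ioo_le {a b : ℝ} (ha : 0 < a) (hab : a < b) (β : ℝ) {c s : ℝ}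
    (hcs : c < s) (hs : s < 40000) :
    volume (limsupLeSet β c ∩ Set.Ioo a b) ≤
      ENNReal.ofReal (39999 / (40000 - s)) * volume (Set.Ioo a b) := by
  have hsub : limsupLeSet β c ∩ Set.Ioo a b ⊆ ⋃ m, smallCountSet β a b s m := by
    rintro α ⟨hα, hI⟩
    have h1 := eventually_lt_of_limsup_lt (lt_of_le_of_lt hα (EReal.coe_lt_coe_iff.2 hcs))
    obtain ⟨m, hm⟩ := eventually_atTop.1 (tendsto_natCast_pow_atTop.eventually h1)
    refine Set.mem_iUnion.2 ⟨m, hI, Set.mem_iInter₂.2 fun k hk => ?_⟩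
    exact (EReal.coe_lt_coe_iff.1 (hm k hk)).le
  refine (measure_mono hsub).trans ?_
  rw [(monotone_smallCountSet β a b s).directed_le.measure_iUnion]
  refine iSup_le fun m => ?_
  have hfin : volume (smallCountSet β a b s m) ≠ ⊤ :=
    ne_top_of_le_ne_top (by simp : volume (Set.Ioo a b) ≠ ⊤) (measure_mono Set.inter_subset_left)
  have hs' : 0 < 40000 - s := by linarith
  rw [Real.volume_Ioo, ← ENNReal.ofReal_mul (by positivity), ← ofReal_measureReal hfin]
  refine ENNReal.ofReal_le_ofReal ?_
  rw [div_mul_eq_mul_div, le_div_iff₀ hs', mul_comm]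
  exact measure_smallCountSet_le ha hab β s m

theorem Set.OrdConnected.exists_Ioo_subset_subset_Icc {I : Set ℝ} (hI : I.OrdConnected) {l u : ℝ}
    (hsub : I ⊆ Set.Ioo l u) (hne : I.Nonempty) :
    ∃ a b, l ≤ a ∧ Set.Ioo a b ⊆ I ∧ I ⊆ Set.Icc a b := by
  have hbelow : BddBelow I := ⟨l, fun x hx => (hsub hx).1.le⟩
  have habove : BddAbove I := ⟨u, fun x hx => (hsub hx).2.le⟩
  refine ⟨sInf I, sSup I, le_csInf hne fun x hx => (hsub hx).1.le, fun x hx => ?_,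
    fun x hx => ⟨csInf_le hbelow hx, le_csSup habove hx⟩⟩
  obtain ⟨y, hy, hyx⟩ := exists_lt_of_csInf_lt hne hx.1
  obtain ⟨w, hw, hxw⟩ := exists_lt_of_lt_csSup hne hx.2
  exact hI.out hy hw ⟨hyx.le, hxw.le⟩

theorem measure_bad_limsup_set_bound :
    ∃ C : ℝ, 1 < C ∧
      ∀ β : ℝ, ∀ n : ℕ, 2 ≤ n → ∀ b₁ b₂ : ℝ, 0 < b₁ → b₁ < b₂ →
        ∀ I : Set ℝ, I.OrdConnected → I ⊆ Set.Ioo b₁ b₂ →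
          volume {α ∈ I |
              Filter.limsup
                  (fun x : ℝ =>
                    (((piStar α β x : ℝ) * (Real.log x) ^ 2 / x : ℝ) : EReal))
                  Filter.atTop ≤ ((1 - 1 / n : ℝ) : EReal)} ≤
            ENNReal.ofReal ((C - 1) / (C - 1 + 1 / (3 * n))) * volume I := by
  refine ⟨40000, by norm_num, fun β n hn b₁ b₂ hb₁ _ I hI hsub => ?_⟩
  rcases I.eq_empty_or_nonempty with rfl | hne
  · simp
  obtain ⟨a, b, hla, hIoo, hIcc⟩ := hI.exists_Ioo_subset_subset_Icc hsub hne
  have ha : 0 < a := hb₁.trans_le hla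
  have hn0 : (0:ℝ) < n := by exact_mod_cast (by omega : 0 < n)
  have hbad : {α ∈ I | Filter.limsup
      (fun x : ℝ => (((piStar α β x : ℝ) * (Real.log x) ^ 2 / x : ℝ) : EReal)) Filter.atTop ≤
        ((1 - 1 / n : ℝ) : EReal)} ⊆ (limsupLeSet β (1 - 1 / n) ∩ Set.Ioo a b) ∪ {a, b} := by
    rintro α ⟨hα, hlim⟩
    obtain ⟨h1, h2⟩ := hIcc hα
    rcases h1.eq_or_lt with h1 | h1
    · exact Or.inr (Or.inl h1.symm)
    rcases h2.eq_or_lt with h2 | h2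
    · exact Or.inr (Or.inr h2)
    exact Or.inl ⟨hlim, h1, h2⟩
  refine (measure_mono hbad).trans ((measure_union_le _ _).trans ?_)
  rw [((Set.finite_singleton b).insert a).measure_zero, add_zero]
  rcases lt_or_ge a b with hab | hab
  · refine (measure_limsupLeSet_inter_Ioo_le ha hab β (s := 1 - 1 / (3 * n)) ?_ ?_).trans ?_
    · rw [sub_lt_sub_iff_left]
      gcongr
      linarith
    · have : 0 < 1 / (3 * n : ℝ) := by positivity
      linarith
    · have e : (39999 : ℝ) / (40000 - (1 - 1 / (3 * n))) =
          (40000 - 1) / (40000 - 1 + 1 / (3 * n)) := by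
        congr 1
        · norm_num
        · ring
      rw [e]
      gcongr
  · rw [Set.Ioo_eq_empty (not_lt.2 hab)]
    simp
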